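/- Let S be a set of n ≥ 4 points in general position in wheel configuration (exactly one interior point). Then the flip graph on the set of all plane spanning paths of S is connected and has diameter at most 2n − 4. -/

import Mathlib

open scoped Classical

noncomputable section

abbrev Pt : Type := ℝ × ℝ

/-- default point -/
def pd : Pt := (0, 0)

/-- No three distinct points of `S` are collinear. -/
def GenPos (S : Finset Pt) : Prop :=
  ∀ p ∈ S, ∀ q ∈ S, ∀ r ∈ S, p ≠ q → p ≠ r → q ≠ r →
    ¬ Collinear ℝ ({p, q, r} : Set Pt)

/-- The (ordered) edges of a path given as a list of vertices. -/
def pathEdges (l : List Pt) : List (Pt × Pt) := l.zip l.tail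

/-- The (ordered) edges of a cycle given as a list of vertices. -/
def cycleEdges (l : List Pt) : List (Pt × Pt) := l.zip (l.rotate 1)

/-- A family of straight-line segments is pairwise non-crossing:
the open segments of any two distinct members are disjoint. -/
def NonCrossing (E : List (Pt × Pt)) : Prop :=
  E.Pairwise fun e f => openSegment ℝ e.1 e.2 ∩ openSegment ℝ f.1 f.2 = ∅

/-- `l` is a plane (crossing-free) straight-line spanning path of `S`. -/
def IsPlanePath (S : Finset Pt) (l : List Pt) : Prop :=
  l.Nodup ∧ l.toFinset = S ∧ NonCrossing (pathEdges l)

/-- `l` is a plane straight-line spanning cycle of `S`. -/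
def IsPlaneCycle (S : Finset Pt) (l : List Pt) : Prop :=
  3 ≤ l.length ∧ l.Nodup ∧ l.toFinset = S ∧ NonCrossing (cycleEdges l)

/-- The set of edges of a path, as unordered pairs. -/
def edgeSet (l : List Pt) : Finset (Sym2 Pt) :=
  ((pathEdges l).map fun e => s(e.1, e.2)).toFinset

/-- The set of edges of a cycle, as unordered pairs. -/
def cycleEdgeSet (l : List Pt) : Finset (Sym2 Pt) :=
  ((cycleEdges l).map fun e => s(e.1, e.2)).toFinset

/-- No segment joining two points of `S` crosses any edge of the cycle `l`. -/
def UncrossedCycle (S : Finset Pt) (l : List Pt) : Prop :=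
  ∀ a ∈ S, ∀ b ∈ S, a ≠ b → ∀ e ∈ cycleEdges l, s(a, b) ≠ s(e.1, e.2) →
    openSegment ℝ a b ∩ openSegment ℝ e.1 e.2 = ∅

/-- Two plane spanning paths of `S` differ by a single flip. -/
def FlipAdj (S : Finset Pt) (P Q : List Pt) : Prop :=
  IsPlanePath S P ∧ IsPlanePath S Q ∧
    ∃ e f, e ≠ f ∧ e ∈ edgeSet P ∧ f ∈ edgeSet Q ∧
      (edgeSet P).erase e = (edgeSet Q).erase f

/-- There is a sequence of `k` flips from `P` to (a representative of) `Q`, all of whose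
members are plane spanning paths of `S` satisfying the additional property `A`. -/
def FlipSeq (S : Finset Pt) (A : List Pt → Prop) (k : ℕ) (P Q : List Pt) : Prop :=
  ∃ f : ℕ → List Pt, f 0 = P ∧ edgeSet (f k) = edgeSet Q ∧
    (∀ i ≤ k, IsPlanePath S (f i) ∧ A (f i)) ∧
    ∀ i < k, FlipAdj S (f i) (f (i + 1))

/-- The flip graph on the plane spanning paths of `S` satisfying `A` is connected. -/
def FlipConnected (S : Finset Pt) (A : List Pt → Prop) : Prop :=
  ∀ P Q : List Pt, IsPlanePath S P → A P → IsPlanePath S Q → A Q →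
    ∃ k, FlipSeq S A k P Q

/-- `uv` is an edge of the boundary of the convex hull of `S`. -/
def HullEdge (S : Finset Pt) (u v : Pt) : Prop :=
  u ∈ S ∧ v ∈ S ∧ u ≠ v ∧ segment ℝ u v ⊆ frontier (convexHull ℝ (S : Set Pt))

/-- `p` is an extreme point (a vertex of the convex hull) of `S`. -/
def ExtremePt (S : Finset Pt) (p : Pt) : Prop :=
  p ∈ S ∧ p ∉ convexHull ℝ ((S.erase p : Finset Pt) : Set Pt)

/-- `p` is a point of `S` lying strictly in the interior of the convex hull of `S`. -/
def InteriorPt (S : Finset Pt) (p : Pt) : Prop :=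
  p ∈ S ∧ p ∈ interior (convexHull ℝ (S : Set Pt))

/-- Twice the signed area of the triangle `a b c` (orientation test). -/
def sign3 (a b c : Pt) : ℝ :=
  (b.1 - a.1) * (c.2 - a.2) - (b.2 - a.2) * (c.1 - a.1)

/-- `S` is a wheel set with center `c0`: points in general position, exactly one
point (`c0`) strictly inside the convex hull, all other points extreme. -/
def WheelSet (S : Finset Pt) (c0 : Pt) : Prop :=
  GenPos S ∧ 4 ≤ S.card ∧ InteriorPt S c0 ∧ ∀ x ∈ S, x ≠ c0 → ExtremePt S x

/-- The number of convex-hull edges of `S` used by the path `l`. -/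
def hullCount (S : Finset Pt) (l : List Pt) : ℕ :=
  ((edgeSet l).filter fun e => ∃ u v, e = s(u, v) ∧ HullEdge S u v).card

/-- `y` follows `x` counterclockwise on the convex hull boundary of `S`. -/
def HullSucc (S : Finset Pt) (x y : Pt) : Prop :=
  x ∈ S ∧ y ∈ S ∧ x ≠ y ∧ ∀ s ∈ S, s ≠ x → s ≠ y → 0 < sign3 x y s

/-- `x` and `y` are consecutive on the convex hull boundary of `S`. -/
def HullAdj (S : Finset Pt) (x y : Pt) : Prop := HullSucc S x y ∨ HullSucc S y x

/-- The open segments `ab` and `pq` are disjoint. -/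
def SegDisj (a b p q : Pt) : Prop := openSegment ℝ a b ∩ openSegment ℝ p q = ∅

section Geometry

variable {S : Finset Pt} {c0 : Pt}

theorem sign3_rotate (a b c : Pt) : sign3 b c a = sign3 a b c := by
  simp only [sign3]; ring

theorem sign3_swap (a b c : Pt) : sign3 a c b = -sign3 a b c := by
  simp only [sign3]; ring

theorem sign3_swap_left (a b c : Pt) : sign3 b a c = -sign3 a b c := by
  simp only [sign3]; ring

@[simp] theorem sign3_self_left (a b : Pt) : sign3 a b a = 0 := by
  simp only [sign3]; ring

@[simp] theorem sign3_self_right (a b : Pt) : sign3 a b b = 0 := by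
  simp only [sign3]; ring

theorem sign3_combo (a b p q : Pt) {s t : ℝ} (h : s + t = 1) :
    sign3 a b (s • p + t • q) = s * sign3 a b p + t * sign3 a b q := by
  obtain rfl : s = 1 - t := by linarith
  simp only [sign3, Prod.fst_add, Prod.snd_add, Prod.smul_fst, Prod.smul_snd, smul_eq_mul]
  ring

theorem SegDisj.symm {a b p q : Pt} (h : SegDisj a b p q) : SegDisj p q a b := by
  unfold SegDisj at *; rwa [Set.inter_comm]

theorem segDisj_congr {a b p q a' b' p' q' : Pt} (h : SegDisj a b p q)
    (h1 : s(a, b) = s(a', b')) (h2 : s(p, q) = s(p', q')) : SegDisj a' b' p' q' := by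
  unfold SegDisj at *
  rw [Sym2.eq_iff] at h1 h2
  rcases h1 with ⟨rfl, rfl⟩ | ⟨rfl, rfl⟩ <;> rcases h2 with ⟨rfl, rfl⟩ | ⟨rfl, rfl⟩ <;>
    first
      | exact h
      | rwa [openSegment_symm ℝ _ a]
      | rwa [openSegment_symm ℝ _ p]
      | (rw [openSegment_symm ℝ b a, openSegment_symm ℝ q p]; exact h)

theorem sq_add_sq_pos {a b : Pt} (hab : a ≠ b) : 0 < (b.1 - a.1) ^ 2 + (b.2 - a.2) ^ 2 := by
  by_contra! hc
  apply hab
  have h1 : b.1 - a.1 = 0 := by nlinarith [sq_nonneg (b.1 - a.1), sq_nonneg (b.2 - a.2)]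
  have h2 : b.2 - a.2 = 0 := by nlinarith [sq_nonneg (b.1 - a.1), sq_nonneg (b.2 - a.2)]
  exact Prod.ext (by linarith) (by linarith)

theorem exists_eq_of_sign3_eq_zero {a b c : Pt} (hab : a ≠ b) (h : sign3 a b c = 0) :
    ∃ r : ℝ, c = (1 - r) • a + r • b := by
  have hd := sq_add_sq_pos hab
  simp only [sign3] at h
  refine ⟨((b.1 - a.1) * (c.1 - a.1) + (b.2 - a.2) * (c.2 - a.2)) /
      ((b.1 - a.1) ^ 2 + (b.2 - a.2) ^ 2), ?_⟩
  apply Prod.ext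
  · simp only [Prod.fst_add, Prod.smul_fst, smul_eq_mul]
    field_simp
    linear_combination (-(b.2 - a.2)) * h
  · simp only [Prod.snd_add, Prod.smul_snd, smul_eq_mul]
    field_simp
    linear_combination (b.1 - a.1) * h

theorem collinear_of_sign3_eq_zero {a b c : Pt} (hab : a ≠ b) (h : sign3 a b c = 0) :
    Collinear ℝ ({a, b, c} : Set Pt) := by
  obtain ⟨r, rfl⟩ := exists_eq_of_sign3_eq_zero hab h
  rw [collinear_iff_of_mem (p₀ := a) (by simp)]
  refine ⟨b - a, ?_⟩
  rintro p (rfl | rfl | rfl)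
  · exact ⟨0, by simp⟩
  · exact ⟨1, by simp⟩
  · exact ⟨r, by simp only [vadd_eq_add]; module⟩

theorem WheelSet.sign3_ne (hW : WheelSet S c0) {p q r : Pt} (hp : p ∈ S) (hq : q ∈ S)
    (hr : r ∈ S) (h1 : p ≠ q) (h2 : p ≠ r) (h3 : q ≠ r) : sign3 p q r ≠ 0 := fun h =>
  hW.1 p hp q hq r hr h1 h2 h3 (collinear_of_sign3_eq_zero h1 h)

theorem exists_separating {x : Pt} {T : Finset Pt}
    (hx : x ∉ convexHull ℝ (T : Set Pt)) :
    ∃ α β : ℝ, ∀ s ∈ T, 0 < α * (s.1 - x.1) + β * (s.2 - x.2) := by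
  have hc : IsClosed (convexHull ℝ (T : Set Pt)) :=
    (T.finite_toSet.isCompact_convexHull ℝ).isClosed
  obtain ⟨f, u, h1, h2⟩ := geometric_hahn_banach_point_closed (convex_convexHull ℝ _) hc hx
  refine ⟨f (1, 0), f (0, 1), fun s hs => ?_⟩
  have h3 := h2 s (subset_convexHull ℝ _ hs)
  have h4 : s - x = (s.1 - x.1) • ((1, 0) : Pt) + (s.2 - x.2) • ((0, 1) : Pt) := by
    ext <;> simp
  have h5 : f (s - x) = (s.1 - x.1) * f (1, 0) + (s.2 - x.2) * f (0, 1) := by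
    rw [h4, map_add, map_smul, map_smul]; rfl
  rw [map_sub] at h5
  linarith

theorem WheelSet.erase_nonempty (hW : WheelSet S c0) {x : Pt} (hx : x ∈ S) :
    (S.erase x).Nonempty := by
  rw [← Finset.card_pos, Finset.card_erase_of_mem hx]
  have := hW.2.1
  omega

theorem WheelSet.exists_succ_pred (hW : WheelSet S c0) {x : Pt} (hx : x ∈ S) (hxc : x ≠ c0) :
    (∃ y, HullSucc S x y) ∧ ∃ y, HullSucc S y x := by
  obtain ⟨α, β, hf⟩ := exists_separating (hW.2.2.2 x hx hxc).2
  set f : Pt → ℝ := fun s => α * (s.1 - x.1) + β * (s.2 - x.2) with hfd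
  set g : Pt → ℝ := fun s => -β * (s.1 - x.1) + α * (s.2 - x.2) with hgd
  have key : ∀ s t : Pt, (α ^ 2 + β ^ 2) * sign3 x s t = f s * g t - g s * f t := by
    intro s t; simp only [hfd, hgd, sign3]; ring
  have hne := hW.erase_nonempty hx
  have hαβ : 0 < α ^ 2 + β ^ 2 := by
    obtain ⟨s, hs⟩ := hne
    have := hf s hs
    by_contra! hc
    have h1 : α = 0 := by nlinarith [sq_nonneg α, sq_nonneg β]
    have h2 : β = 0 := by nlinarith [sq_nonneg α, sq_nonneg β]
    simp [h1, h2] at this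
  have pos : ∀ s t : Pt, s ∈ S.erase x → t ∈ S.erase x → s ≠ t →
      g s / f s ≤ g t / f t → 0 < sign3 x s t := by
    intro s t hs ht hst hle
    have h1 := hf s hs
    have h2 := hf t ht
    have h3 : sign3 x s t ≠ 0 := hW.sign3_ne hx (Finset.mem_of_mem_erase hs)
      (Finset.mem_of_mem_erase ht) (Finset.ne_of_mem_erase hs).symm
      (Finset.ne_of_mem_erase ht).symm hst
    rw [div_le_div_iff₀ h1 h2] at hle
    have h4 := key s t
    rcases lt_or_gt_of_ne h3 with h5 | h5
    · nlinarith [mul_pos_of_neg_of_neg (neg_neg_of_pos hαβ) h5]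
    · exact h5
  constructor
  · obtain ⟨y, hy, hmin⟩ := Finset.exists_min_image (S.erase x) (fun s => g s / f s) hne
    refine ⟨y, hx, Finset.mem_of_mem_erase hy, (Finset.ne_of_mem_erase hy).symm, ?_⟩
    intro s hs hsx hsy
    have hs' := Finset.mem_erase.2 ⟨hsx, hs⟩
    exact pos y s hy hs' hsy.symm (hmin s hs')
  · obtain ⟨y, hy, hmax⟩ := Finset.exists_max_image (S.erase x) (fun s => g s / f s) hne
    refine ⟨y, Finset.mem_of_mem_erase hy, hx, Finset.ne_of_mem_erase hy, ?_⟩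
    intro s hs hsy hsx
    have hs' := Finset.mem_erase.2 ⟨hsx, hs⟩
    rw [← sign3_rotate]
    exact pos s y hs' hy hsy (hmax s hs')

theorem HullSucc.nonneg {x y : Pt} (h : HullSucc S x y) {s : Pt} (hs : s ∈ S) :
    0 ≤ sign3 x y s := by
  by_cases h1 : s = x
  · simp [h1]
  by_cases h2 : s = y
  · simp [h2]
  exact (h.2.2.2 s hs h1 h2).le

theorem WheelSet.succ_center (hW : WheelSet S c0) {x y : Pt} (h : HullSucc S x y) :
    0 < sign3 x y c0 := by
  have hsub : convexHull ℝ (S : Set Pt) ⊆ {s | 0 ≤ sign3 x y s} := by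
    refine convexHull_min (fun s hs => h.nonneg hs) ?_
    intro p hp q hq s t hs ht hst
    simp only [Set.mem_ofPred_eq] at *
    rw [sign3_combo _ _ _ _ hst]
    positivity
  have hint := mem_interior_iff_mem_nhds.1 hW.2.2.1.2
  let γ : ℝ → Pt := fun ε => (c0.1 + ε * (y.2 - x.2), c0.2 - ε * (y.1 - x.1))
  have hγ : Continuous γ := by fun_prop
  have h0 : γ 0 = c0 := by simp [γ]
  have hev : ∀ᶠ ε in nhds (0 : ℝ), γ ε ∈ convexHull ℝ (S : Set Pt) :=
    hγ.continuousAt.eventually (by rw [h0]; exact hint)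
  obtain ⟨δ, hδ, hball⟩ := Metric.eventually_nhds_iff.1 hev
  have h1 := hsub (hball (y := δ / 2) (by
    rw [Real.dist_eq, sub_zero, abs_of_pos (by linarith)]; linarith))
  have h2 : sign3 x y (γ (δ / 2)) =
      sign3 x y c0 - δ / 2 * ((y.1 - x.1) ^ 2 + (y.2 - x.2) ^ 2) := by
    simp only [γ, sign3]; ring
  simp only [Set.mem_ofPred_eq, h2] at h1
  have hd := sq_add_sq_pos h.2.2.1
  have : 0 < δ / 2 * ((y.1 - x.1) ^ 2 + (y.2 - x.2) ^ 2) := by positivity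
  linarith

theorem WheelSet.ne_center_of_succ (hW : WheelSet S c0) {x y : Pt} (h : HullSucc S x y) :
    x ≠ c0 ∧ y ≠ c0 := by
  have := hW.succ_center h
  constructor <;> rintro rfl <;> simp at this

theorem HullSucc.right_unique {x y y' : Pt} (h : HullSucc S x y) (h' : HullSucc S x y') :
    y = y' := by
  by_contra hne
  have h1 := h.2.2.2 y' h'.2.1 h'.2.2.1.symm (Ne.symm hne)
  have h2 := h'.2.2.2 y h.2.1 h.2.2.1.symm hne
  rw [sign3_swap] at h2
  linarith

theorem HullSucc.left_unique {x y y' : Pt} (h : HullSucc S y x) (h' : HullSucc S y' x) :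
    y = y' := by
  by_contra hne
  have h1 := h.2.2.2 y' h'.1 (Ne.symm hne) h'.2.2.1
  have h2 := h'.2.2.2 y h.1 hne h.2.2.1
  rw [← sign3_rotate, sign3_swap_left] at h2
  rw [sign3_rotate] at h2
  linarith [sign3_rotate y x y', sign3_swap_left x y y', sign3_rotate y' y x,
    sign3_rotate x y' y]

theorem HullAdj.symm {x y : Pt} (h : HullAdj S x y) : HullAdj S y x := Or.symm h

theorem HullAdj.mem_left {x y : Pt} (h : HullAdj S x y) : x ∈ S := h.elim (·.1) (·.2.1)

theorem HullAdj.mem_right {x y : Pt} (h : HullAdj S x y) : y ∈ S := h.symm.mem_left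

theorem HullAdj.ne {x y : Pt} (h : HullAdj S x y) : x ≠ y :=
  h.elim (·.2.2.1) (·.2.2.1.symm)

theorem WheelSet.ne_center (hW : WheelSet S c0) {x y : Pt} (h : HullAdj S x y) : x ≠ c0 :=
  h.elim (fun h => (hW.ne_center_of_succ h).1) (fun h => (hW.ne_center_of_succ h).2)

theorem WheelSet.ne_center_right (hW : WheelSet S c0) {x y : Pt} (h : HullAdj S x y) : y ≠ c0 :=
  hW.ne_center h.symm

theorem WheelSet.succ_asymm (hW : WheelSet S c0) {x y : Pt} (h : HullSucc S x y) :
    ¬ HullSucc S y x := fun h' => by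
  have h1 := hW.succ_center h
  have h2 := hW.succ_center h'
  rw [sign3_swap_left] at h2
  linarith

theorem HullSucc.segDisj {x y p q : Pt} (h : HullSucc S x y) (hp : p ∈ S) (hq : q ∈ S)
    (hpq : p ≠ q) (hne : s(p, q) ≠ s(x, y)) : SegDisj x y p q := by
  rw [SegDisj, Set.eq_empty_iff_forall_notMem]
  rintro z ⟨⟨s, t, hs, ht, hst, rfl⟩, ⟨s', t', hs', ht', hst', h1⟩⟩
  have h2 := congrArg (sign3 x y) h1
  rw [sign3_combo _ _ _ _ hst, sign3_combo _ _ _ _ hst'] at h2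
  simp only [sign3_self_left, sign3_self_right, mul_zero, add_zero] at h2
  have hp0 := h.nonneg hp
  have hq0 := h.nonneg hq
  have hp1 : sign3 x y p = 0 := by nlinarith [mul_nonneg hs'.le hp0, mul_nonneg ht'.le hq0]
  have hq1 : sign3 x y q = 0 := by nlinarith [mul_nonneg hs'.le hp0, mul_nonneg ht'.le hq0]
  have on : ∀ r ∈ S, sign3 x y r = 0 → r = x ∨ r = y := by
    intro r hr h0
    by_contra! hc
    exact (h.2.2.2 r hr hc.1 hc.2).ne' h0
  rcases on p hp hp1 with rfl | rfl <;> rcases on q hq hq1 with rfl | rfl <;>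
    simp_all [Sym2.eq_swap]

theorem HullAdj.segDisj {x y p q : Pt} (h : HullAdj S x y) (hp : p ∈ S) (hq : q ∈ S)
    (hpq : p ≠ q) (hne : s(p, q) ≠ s(x, y)) : SegDisj x y p q := by
  rcases h with h | h
  · exact h.segDisj hp hq hpq hne
  · exact segDisj_congr (h.segDisj hp hq hpq (by rwa [Sym2.eq_swap (a := y)])) Sym2.eq_swap rfl

theorem WheelSet.segDisj_of_common (hW : WheelSet S c0) {c a b : Pt} (hc : c ∈ S) (ha : a ∈ S)
    (hb : b ∈ S) (h1 : c ≠ a) (h2 : c ≠ b) (h3 : a ≠ b) : SegDisj c a c b := by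
  rw [SegDisj, Set.eq_empty_iff_forall_notMem]
  rintro z ⟨⟨s, t, hs, ht, hst, rfl⟩, ⟨s', t', hs', ht', hst', h4⟩⟩
  have h5 := congrArg (sign3 c a) h4
  rw [sign3_combo _ _ _ _ hst, sign3_combo _ _ _ _ hst'] at h5
  simp [ht'.ne', hW.sign3_ne hc ha hb h1 h2 h3] at h5

/-- A segment of `S` joining the two sides of a chord between hull vertices meets the chord. -/
theorem WheelSet.exists_crossing (hW : WheelSet S c0) {x y p q : Pt} (hx : x ∈ S) (hy : y ∈ S)
    (hxc : x ≠ c0) (hyc : y ≠ c0) (hp : p ∈ S) (hq : q ∈ S) (hpx : p ≠ x) (hpy : p ≠ y)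
    (hqx : q ≠ x) (hqy : q ≠ y) (h : sign3 x y p * sign3 x y q < 0) :
    ¬ SegDisj x y p q := by
  have hxy : x ≠ y := by rintro rfl; simp [sign3] at h
  have hpq : p ≠ q := by rintro rfl; nlinarith [mul_self_nonneg (sign3 x y p)]
  wlog hpos : 0 < sign3 x y p generalizing p q
  · have hneg : sign3 x y p < 0 := by
      rcases lt_trichotomy (sign3 x y p) 0 with h' | h' | h'
      · exact h'
      · simp [h'] at h
      · exact absurd h' hpos
    have hq' : 0 < sign3 x y q := by
      by_contra! hc
      nlinarith [mul_nonneg_of_nonpos_of_nonpos hneg.le hc]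
    intro hd
    exact this hq hp hqx hqy hpx hpy (by rwa [mul_comm]) hpq.symm hq'
      (segDisj_congr hd rfl Sym2.eq_swap)
  have hneg : sign3 x y q < 0 := by
    by_contra! hc
    nlinarith [mul_nonneg hpos.le hc]
  set α := sign3 x y p with hα
  set β := -sign3 x y q with hβ
  have hβ0 : 0 < β := by linarith
  have hαβ : 0 < α + β := by linarith
  obtain ⟨s, t, hs, ht, hst, hz0⟩ : ∃ s t : ℝ, 0 < s ∧ 0 < t ∧ s + t = 1 ∧
      sign3 x y (s • p + t • q) = 0 := by
    have hsum : β / (α + β) + α / (α + β) = 1 := by field_simp; ring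
    refine ⟨β / (α + β), α / (α + β), by positivity, by positivity, hsum, ?_⟩
    rw [sign3_combo _ _ _ _ hsum, ← hα, show sign3 x y q = -β by simp [hβ]]
    ring
  set z := s • p + t • q with hz
  obtain ⟨r, hr⟩ := exists_eq_of_sign3_eq_zero hxy hz0
  have pos : ∀ u v : Pt, HullSucc S u v → p ≠ u → q ≠ u → 0 < sign3 u v z := by
    intro u v huv hpu hqu
    rw [hz, sign3_combo _ _ _ _ hst]
    by_cases hpv : p = v
    · have := huv.2.2.2 q hq hqu (by rintro rfl; exact hpq hpv)
      rw [hpv]; simp only [sign3_self_right, mul_zero, zero_add]; positivity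
    · have := huv.2.2.2 p hp hpu hpv
      have h3 := huv.nonneg hq
      positivity
  obtain ⟨y', hy'⟩ := (hW.exists_succ_pred hy hyc).1
  obtain ⟨x', hx'⟩ := (hW.exists_succ_pred hx hxc).1
  have h1 := pos y y' hy' hpy hqy
  have h2 := pos x x' hx' hpx hqx
  rw [hr, sign3_combo _ _ _ _ (by ring)] at h1 h2
  simp only [sign3_self_left, mul_zero, add_zero, zero_add] at h1 h2
  have h3 : 0 < 1 - r := pos_of_mul_pos_left h1 (hy'.nonneg hx)
  have h4 : 0 < r := pos_of_mul_pos_left h2 (hx'.nonneg hy)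
  intro hd
  have : z ∈ openSegment ℝ x y ∩ openSegment ℝ p q :=
    ⟨⟨1 - r, r, h3, h4, by ring, hr.symm⟩, ⟨s, t, hs, ht, hst, rfl⟩⟩
  rw [SegDisj] at hd
  simp [hd] at this

theorem WheelSet.opposite_of_crossing (hW : WheelSet S c0) {a b p q : Pt} (ha : a ∈ S)
    (hp : p ∈ S) (hq : q ∈ S) (hpq : p ≠ q) (hpa : p ≠ a) (hqa : q ≠ a) (h : ¬ SegDisj a b p q) :
    sign3 p q a * sign3 p q b < 0 := by
  rw [SegDisj, ← Ne, ← Set.nonempty_iff_ne_empty] at h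
  obtain ⟨z, ⟨s, t, hs, ht, hst, rfl⟩, ⟨s', t', hs', ht', hst', h4⟩⟩ := h
  have h5 := congrArg (sign3 p q) h4
  rw [sign3_combo _ _ _ _ hst, sign3_combo _ _ _ _ hst'] at h5
  simp only [sign3_self_left, sign3_self_right, mul_zero, add_zero] at h5
  have h6 : sign3 p q a ≠ 0 := hW.sign3_ne hp hq ha hpq hpa hqa
  have h7 : s * sign3 p q a ^ 2 + t * (sign3 p q a * sign3 p q b) = 0 := by
    linear_combination -sign3 p q a * h5
  have h8 : 0 < s * sign3 p q a ^ 2 := by positivity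
  by_contra! hc
  nlinarith [mul_nonneg ht.le hc]

theorem HullAdj.separates {y z w v : Pt} (hz : HullAdj S y z)
    (hw : HullAdj S y w) (hzw : z ≠ w) (hv : v ∈ S) (hvy : v ≠ y) (hvz : v ≠ z)
    (hvw : v ≠ w) : sign3 y v z * sign3 y v w < 0 := by
  have aux : ∀ z w : Pt, HullSucc S y z → HullSucc S w y → v ≠ z → v ≠ w →
      sign3 y v z * sign3 y v w < 0 := by
    intro z w hz hw hvz hvw
    have h1 := hz.2.2.2 v hv hvy hvz
    have h2 := hw.2.2.2 v hv hvw hvy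
    rw [sign3_swap y z v, sign3_rotate w y v]
    nlinarith [mul_pos h1 h2]
  rcases hz with hz | hz <;> rcases hw with hw | hw
  · exact absurd (hz.right_unique hw) hzw
  · exact aux z w hz hw hvz hvw
  · rw [mul_comm]; exact aux w z hw hz hvw hvz
  · exact absurd (hz.left_unique hw) hzw

theorem WheelSet.exists_two_adj (hW : WheelSet S c0) {x : Pt} (hx : x ∈ S) (hxc : x ≠ c0) :
    ∃ y z, y ≠ z ∧ HullAdj S x y ∧ HullAdj S x z := by
  obtain ⟨⟨y, hy⟩, z, hz⟩ := hW.exists_succ_pred hx hxc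
  refine ⟨y, z, ?_, Or.inl hy, Or.inr hz⟩
  rintro rfl
  exact hW.succ_asymm hy hz

theorem WheelSet.exists_adj_ne (hW : WheelSet S c0) {x : Pt} (hx : x ∈ S) (hxc : x ≠ c0)
    (v : Pt) : ∃ y, y ≠ v ∧ HullAdj S x y := by
  obtain ⟨y, z, hyz, hy, hz⟩ := hW.exists_two_adj hx hxc
  by_cases h : y = v
  · exact ⟨z, fun h' => hyz (h.trans h'.symm), hz⟩
  · exact ⟨y, h, hy⟩

theorem WheelSet.adj_of_same_side (hW : WheelSet S c0) {x y : Pt} (hx : x ∈ S) (hy : y ∈ S)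
    (hxc : x ≠ c0) (hxy : x ≠ y)
    (h : ∀ p ∈ S, ∀ q ∈ S, p ≠ c0 → q ≠ c0 → p ≠ x → p ≠ y → q ≠ x → q ≠ y →
      0 < sign3 x y p * sign3 x y q) : HullAdj S x y := by
  obtain ⟨p, q, hpq, hp, hq⟩ := hW.exists_two_adj hx hxc
  by_cases h1 : p = y
  · exact h1 ▸ hp
  by_cases h2 : q = y
  · exact h2 ▸ hq
  have h3 := hp.separates hq hpq hy hxy.symm (Ne.symm h1) (Ne.symm h2)
  have h4 := h p hp.mem_right q hq.mem_right (hW.ne_center_right hp) (hW.ne_center_right hq)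
    hp.ne.symm h1 hq.ne.symm h2
  linarith

end Geometry

section PathLists

variable {S : Finset Pt} {c0 : Pt}

@[simp] theorem edgeSet_nil : edgeSet [] = ∅ := by simp [edgeSet, pathEdges]

@[simp] theorem edgeSet_singleton (x : Pt) : edgeSet [x] = ∅ := by simp [edgeSet, pathEdges]

@[simp] theorem edgeSet_cons_cons (x y : Pt) (t : List Pt) :
    edgeSet (x :: y :: t) = insert s(x, y) (edgeSet (y :: t)) := by
  simp [edgeSet, pathEdges]

theorem edgeSet_append (X Z : List Pt) (y z : Pt) :
    edgeSet (X ++ y :: z :: Z) = edgeSet (X ++ [y]) ∪ insert s(y, z) (edgeSet (z :: Z)) := by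
  induction X with
  | nil => simp
  | cons x X ih =>
    cases X with
    | nil => ext; simp [or_left_comm]
    | cons x' X =>
      simp only [List.cons_append, edgeSet_cons_cons] at ih ⊢
      rw [ih, Finset.insert_union]

theorem edgeSet_reverse (l : List Pt) : edgeSet l.reverse = edgeSet l := by
  induction l with
  | nil => rfl
  | cons x t ih =>
    cases t with
    | nil => rfl
    | cons y t =>
      have h : (x :: y :: t).reverse = t.reverse ++ y :: x :: [] := by simp
      have h' : t.reverse ++ [y] = (y :: t).reverse := by simp
      rw [h, edgeSet_append, h', ih, edgeSet_cons_cons, Sym2.eq_swap (a := y)]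
      ext; simp [or_comm]

theorem mem_of_edge {a b : Pt} {l : List Pt} (h : s(a, b) ∈ edgeSet l) : a ∈ l ∧ b ∈ l := by
  induction l with
  | nil => simp at h
  | cons x t ih =>
    cases t with
    | nil => simp at h
    | cons y t =>
      rw [edgeSet_cons_cons, Finset.mem_insert, Sym2.eq_iff] at h
      rcases h with (⟨rfl, rfl⟩ | ⟨rfl, rfl⟩) | h
      · simp
      · simp
      · exact ⟨List.mem_cons_of_mem _ (ih h).1, List.mem_cons_of_mem _ (ih h).2⟩

theorem nodup_edges {l : List Pt} (h : l.Nodup) :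
    ((pathEdges l).map fun e => s(e.1, e.2)).Nodup := by
  induction l with
  | nil => simp [pathEdges]
  | cons x t ih =>
    cases t with
    | nil => simp [pathEdges]
    | cons y t =>
      have h1 : pathEdges (x :: y :: t) = (x, y) :: pathEdges (y :: t) := rfl
      rw [h1, List.map_cons, List.nodup_cons]
      refine ⟨fun hm => ?_, ih h.of_cons⟩
      have h2 : s(x, y) ∈ edgeSet (y :: t) := by simpa only [edgeSet, List.mem_toFinset] using hm
      exact (List.nodup_cons.1 h).1 (mem_of_edge h2).1

theorem card_edgeSet {l : List Pt} (h : l.Nodup) : (edgeSet l).card = l.length - 1 := by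
  rw [edgeSet, List.toFinset_card_of_nodup (nodup_edges h)]
  simp [pathEdges]

theorem ne_of_edge {a b : Pt} {l : List Pt} (hl : l.Nodup) (h : s(a, b) ∈ edgeSet l) :
    a ≠ b := by
  induction l with
  | nil => simp at h
  | cons x t ih =>
    cases t with
    | nil => simp at h
    | cons y t =>
      rw [edgeSet_cons_cons, Finset.mem_insert, Sym2.eq_iff] at h
      have hxy : x ≠ y := fun he => (List.nodup_cons.1 hl).1 (by simp [he])
      rcases h with (⟨rfl, rfl⟩ | ⟨rfl, rfl⟩) | h
      · exact hxy
      · exact hxy.symm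
      · exact ih hl.of_cons h

/-- A crossing-free path on some of the points of `S`. -/
structure PlaneOn (S : Finset Pt) (l : List Pt) : Prop where
  nodup : l.Nodup
  mem : ∀ x ∈ l, x ∈ S
  disj : ∀ a b p q, s(a, b) ∈ edgeSet l → s(p, q) ∈ edgeSet l → s(a, b) ≠ s(p, q) →
    SegDisj a b p q

theorem isPlanePath_iff {l : List Pt} : IsPlanePath S l ↔ PlaneOn S l ∧ l.toFinset = S := by
  have mem_iff : ∀ e : Sym2 Pt, e ∈ edgeSet l ↔ ∃ f ∈ pathEdges l, s(f.1, f.2) = e := by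
    intro e; simp [edgeSet]
  constructor
  · rintro ⟨h1, h2, h3⟩
    refine ⟨⟨h1, fun x hx => by rw [← h2]; simpa using hx, ?_⟩, h2⟩
    intro a b p q hab hpq hne
    obtain ⟨e, he, he'⟩ := (mem_iff _).1 hab
    obtain ⟨f, hf, hf'⟩ := (mem_iff _).1 hpq
    have hef : e ≠ f := by rintro rfl; exact hne (he'.symm.trans hf')
    have : Std.Symm fun e f : Pt × Pt => openSegment ℝ e.1 e.2 ∩ openSegment ℝ f.1 f.2 = ∅ :=
      ⟨fun _ _ h => by rwa [Set.inter_comm]⟩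
    have h4 : SegDisj e.1 e.2 f.1 f.2 := List.Pairwise.forall h3 he hf hef
    exact segDisj_congr h4 he' hf'
  · rintro ⟨h1, h2⟩
    refine ⟨h1.nodup, h2, ?_⟩
    have h3 : (pathEdges l).Pairwise fun e f => s(e.1, e.2) ≠ s(f.1, f.2) :=
      List.pairwise_map.1 (nodup_edges h1.nodup)
    refine h3.imp_of_mem ?_
    intro e f he hf hne
    exact h1.disj _ _ _ _ ((mem_iff _).2 ⟨e, he, rfl⟩) ((mem_iff _).2 ⟨f, hf, rfl⟩) hne

theorem IsPlanePath.planeOn {l : List Pt} (h : IsPlanePath S l) : PlaneOn S l :=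
  (isPlanePath_iff.1 h).1

theorem IsPlanePath.mem_iff {l : List Pt} (h : IsPlanePath S l) {x : Pt} : x ∈ l ↔ x ∈ S := by
  rw [← h.2.1, List.mem_toFinset]

theorem IsPlanePath.length {l : List Pt} (h : IsPlanePath S l) : l.length = S.card := by
  rw [← h.2.1, List.toFinset_card_of_nodup h.1]

theorem PlaneOn.reverse {l : List Pt} (h : PlaneOn S l) : PlaneOn S l.reverse :=
  ⟨List.nodup_reverse.2 h.nodup, fun x hx => h.mem x (List.mem_reverse.1 hx), by
    rw [edgeSet_reverse]; exact h.disj⟩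

theorem IsPlanePath.reverse {l : List Pt} (h : IsPlanePath S l) : IsPlanePath S l.reverse :=
  isPlanePath_iff.2 ⟨h.planeOn.reverse, by rw [List.toFinset_reverse, h.2.1]⟩

theorem flipAdj_of_insert {P Q : List Pt} {p q : Pt} (hP : IsPlanePath S P)
    (hQ : Q.Perm P) (hfQ : s(p, q) ∈ edgeSet Q) (hfP : s(p, q) ∉ edgeSet P)
    (hsub : edgeSet Q ⊆ insert s(p, q) (edgeSet P))
    (hd : ∀ a b, s(a, b) ∈ edgeSet P → SegDisj p q a b) : FlipAdj S P Q := by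
  have hn : Q.Nodup := hQ.nodup_iff.2 hP.1
  have hQS : Q.toFinset = S := by rw [List.toFinset_eq_of_perm _ _ hQ, hP.2.1]
  have hM : (edgeSet Q).erase s(p, q) ⊆ edgeSet P := by
    intro e he
    rw [Finset.mem_erase] at he
    exact (Finset.mem_insert.1 (hsub he.2)).resolve_left he.1
  have hcard : ((edgeSet Q).erase s(p, q)).card + 1 = (edgeSet P).card := by
    rw [Finset.card_erase_add_one hfQ, card_edgeSet hn, card_edgeSet hP.1, hQ.length_eq]
  obtain ⟨e, he, hins⟩ := Finset.exists_eq_insert_iff.2 ⟨hM, hcard⟩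
  refine ⟨hP, isPlanePath_iff.2 ⟨⟨hn, ?_, ?_⟩, hQS⟩, e, s(p, q), ?_, ?_, hfQ, ?_⟩
  · intro x hx; rw [← hQS]; simpa using hx
  · intro a b a' b' h1 h2 hne
    rcases Finset.mem_insert.1 (hsub h1) with h1' | h1' <;>
      rcases Finset.mem_insert.1 (hsub h2) with h2' | h2'
    · exact absurd (h1'.trans h2'.symm) hne
    · exact segDisj_congr (hd _ _ h2') h1'.symm rfl
    · exact (segDisj_congr (hd _ _ h1') h2'.symm rfl).symm
    · exact hP.planeOn.disj _ _ _ _ h1' h2' hne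
  · rintro rfl
    exact hfP (hins ▸ Finset.mem_insert_self _ _)
  · exact hins ▸ Finset.mem_insert_self _ _
  · rw [← hins, Finset.erase_insert he]

theorem head_last_split {T : List Pt} {z w : Pt} (hz : T.head? = some z)
    (hw : T.getLast? = some w) (hzw : z ≠ w) : ∃ M, T = z :: (M ++ [w]) := by
  obtain ⟨T', rfl⟩ := List.head?_eq_some_iff.1 hz
  rcases List.eq_nil_or_concat' T' with rfl | ⟨M, w', rfl⟩
  · simp at hw; exact absurd hw hzw
  · rw [← List.cons_append, List.getLast?_concat] at hw
    exact ⟨M, by rw [Option.some.inj hw]⟩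

/-- Reversing the part of a path behind one of its vertices is a flip. -/
theorem flipAdj_suffix {X T : List Pt} {y z w : Pt} (hP : IsPlanePath S (X ++ y :: T))
    (hz : T.head? = some z) (hw : T.getLast? = some w) (hzw : z ≠ w)
    (hd : ∀ a b, s(a, b) ∈ edgeSet (X ++ y :: T) → s(a, b) ≠ s(y, w) → SegDisj y w a b) :
    FlipAdj S (X ++ y :: T) (X ++ y :: T.reverse) := by
  obtain ⟨M, rfl⟩ := head_last_split hz hw hzw
  have hrev : w :: (M.reverse ++ [z]) = (z :: (M ++ [w])).reverse := by simp
  have hn := hP.1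
  have hnot : s(y, w) ∉ edgeSet (X ++ y :: z :: (M ++ [w])) := by
    intro h
    rw [edgeSet_append, Finset.mem_union, Finset.mem_insert] at h
    simp only [List.nodup_append, List.nodup_cons, List.mem_append, List.mem_cons] at hn
    rcases h with h | h | h
    · have := (mem_of_edge h).2
      simp only [List.mem_append, List.mem_singleton] at this
      grind
    · rw [Sym2.eq_iff] at h
      grind
    · have := (mem_of_edge h).1
      simp only [List.mem_append, List.mem_cons] at this
      grind
  refine flipAdj_of_insert (p := y) (q := w) hP ?_ ?_ hnot ?_
    fun a b h => hd a b h fun he => hnot (he ▸ h)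
  · exact ((List.reverse_perm _).cons y).append_left X
  · rw [← hrev, edgeSet_append]; simp
  · rw [← hrev, edgeSet_append, hrev, edgeSet_reverse, edgeSet_append]
    intro e he
    simp only [Finset.mem_union, Finset.mem_insert] at he ⊢
    tauto

/-- The number of edges of the path `l` that are not hull edges of `S`. -/
def defect (S : Finset Pt) : List Pt → ℕ
  | x :: y :: t => (if HullAdj S x y then 0 else 1) + defect S (y :: t)
  | _ => 0

@[simp] theorem defect_nil : defect S [] = 0 := rfl

@[simp] theorem defect_singleton (x : Pt) : defect S [x] = 0 := rfl

theorem defect_cons_cons (x y : Pt) (t : List Pt) :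
    defect S (x :: y :: t) = (if HullAdj S x y then 0 else 1) + defect S (y :: t) := rfl

theorem defect_append (X Z : List Pt) (y z : Pt) :
    defect S (X ++ y :: z :: Z) =
      defect S (X ++ [y]) + (if HullAdj S y z then 0 else 1) + defect S (z :: Z) := by
  induction X with
  | nil => simp [defect_cons_cons]
  | cons x X ih =>
    cases X with
    | nil => simp [defect_cons_cons]; ring
    | cons x' X =>
      simp only [List.cons_append, defect_cons_cons] at ih ⊢
      rw [ih]; ring

theorem defect_reverse (l : List Pt) : defect S l.reverse = defect S l := by
  induction l with
  | nil => rfl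
  | cons x t ih =>
    cases t with
    | nil => rfl
    | cons y t =>
      have h : (x :: y :: t).reverse = t.reverse ++ y :: x :: [] := by simp
      have h' : t.reverse ++ [y] = (y :: t).reverse := by simp
      have hs : HullAdj S y x ↔ HullAdj S x y := ⟨.symm, .symm⟩
      rw [h, defect_append, h', ih, defect_cons_cons]
      simp [hs, add_comm]

theorem defect_le (l : List Pt) : defect S l ≤ l.length - 1 := by
  induction l with
  | nil => simp
  | cons x t ih =>
    cases t with
    | nil => simp
    | cons y t =>
      rw [defect_cons_cons]
      simp only [List.length_cons] at ih ⊢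
      split_ifs <;> omega

theorem isChain_of_defect {l : List Pt} (h : defect S l = 0) : l.IsChain (HullAdj S) := by
  induction l with
  | nil => simp
  | cons x t ih =>
    cases t with
    | nil => simp
    | cons y t =>
      rw [defect_cons_cons] at h
      rw [List.isChain_cons_cons]
      refine ⟨?_, ih (by omega)⟩
      by_contra hc
      simp [hc] at h

theorem defect_le_of_ends {l : List Pt} (hl : 3 ≤ l.length)
    (h1 : ∀ x y Y, l = x :: y :: Y → HullAdj S x y)
    (h2 : ∀ x y Y, l.reverse = x :: y :: Y → HullAdj S x y) : defect S l + 3 ≤ l.length := by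
  obtain ⟨x, y, z, T, rfl⟩ : ∃ x y z T, l = x :: y :: z :: T := by
    match l, hl with
    | x :: y :: z :: T, _ => exact ⟨x, y, z, T, rfl⟩
  obtain ⟨w, v, R, hR⟩ : ∃ w v R, (y :: z :: T).reverse = w :: v :: R := by
    have : (y :: z :: T).reverse.length = T.length + 2 := by simp
    match h : (y :: z :: T).reverse, this with
    | w :: v :: R, _ => exact ⟨w, v, R, rfl⟩
  have hlen := congrArg List.length hR
  have h3 := h1 x y _ rfl
  have h4 := h2 w v (R ++ [x]) (by rw [List.reverse_cons, hR]; rfl)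
  have h5 : defect S (y :: z :: T) = defect S (v :: R) := by
    rw [← defect_reverse, hR, defect_cons_cons, if_pos h4, zero_add]
  have h6 := defect_le (S := S) (v :: R)
  rw [defect_cons_cons, if_pos h3, h5]
  simp at hlen h6 ⊢
  omega

theorem exists_of_defect_ne {l : List Pt} (h : defect S l ≠ 0) :
    ∃ X p q Y, l = X ++ p :: q :: Y ∧ ¬ HullAdj S p q := by
  induction l with
  | nil => simp at h
  | cons x t ih =>
    cases t with
    | nil => simp at h
    | cons y t =>
      by_cases hxy : HullAdj S x y
      · rw [defect_cons_cons, if_pos hxy, zero_add] at h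
        obtain ⟨X, p, q, Y, h1, h2⟩ := ih h
        exact ⟨x :: X, p, q, Y, by rw [h1]; rfl, h2⟩
      · exact ⟨[], x, y, t, rfl, hxy⟩

/-- A flip that trades a non-hull edge for a hull edge at the end of the path. -/
theorem flipAdj_suffix_hull {X T : List Pt} {y z w : Pt} (hP : IsPlanePath S (X ++ y :: T))
    (hz : T.head? = some z) (hw : T.getLast? = some w) (hyw : HullAdj S y w)
    (hyz : ¬ HullAdj S y z) :
    FlipAdj S (X ++ y :: T) (X ++ y :: T.reverse) ∧
      defect S (X ++ y :: T.reverse) + 1 = defect S (X ++ y :: T) := by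
  have hzw : z ≠ w := by rintro rfl; exact hyz hyw
  refine ⟨flipAdj_suffix hP hz hw hzw fun a b h hne => hyw.segDisj
    (hP.planeOn.mem _ (mem_of_edge h).1) (hP.planeOn.mem _ (mem_of_edge h).2)
    (ne_of_edge hP.1 h) hne, ?_⟩
  obtain ⟨M, rfl⟩ := head_last_split hz hw hzw
  have hrev : (z :: (M ++ [w])).reverse = w :: (M.reverse ++ [z]) := by simp
  rw [hrev, defect_append, ← hrev, defect_reverse, defect_append, if_pos hyw, if_neg hyz]
  ring

/-- Closing a path by a hull edge and opening it next to the center is a flip. -/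
theorem flipAdj_rotate (hW : WheelSet S c0) {A B : List Pt} {x w : Pt}
    (hP : IsPlanePath S (A ++ c0 :: B)) (hx : A.head? = some x) (hw : B.getLast? = some w)
    (hxw : HullAdj S x w) :
    FlipAdj S (A ++ c0 :: B) (c0 :: (B ++ A)) ∧
      defect S (c0 :: (B ++ A)) + 1 = defect S (A ++ c0 :: B) := by
  obtain ⟨A1, rfl⟩ := List.head?_eq_some_iff.1 hx
  obtain ⟨B1, rfl⟩ := List.getLast?_eq_some_iff.1 hw
  obtain ⟨A2, a, hA⟩ : ∃ A2 a, x :: A1 = A2 ++ [a] := by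
    rcases List.eq_nil_or_concat' (x :: A1) with h | ⟨A2, a, h⟩
    · simp at h
    · exact ⟨A2, a, h⟩
  have hP' : x :: A1 ++ c0 :: (B1 ++ [w]) = A2 ++ a :: c0 :: (B1 ++ [w]) := by
    rw [hA]; simp
  have hQ' : c0 :: (B1 ++ [w] ++ x :: A1) = (c0 :: B1) ++ w :: x :: A1 := by simp
  have hac : ¬ HullAdj S a c0 := fun h => hW.ne_center_right h rfl
  have hn := hP.1
  have hnot : s(w, x) ∉ edgeSet (x :: A1 ++ c0 :: (B1 ++ [w])) := by
    intro h
    rw [hP', edgeSet_append, ← hA, Finset.mem_union, Finset.mem_insert] at h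
    simp only [List.nodup_append, List.nodup_cons, List.mem_append, List.mem_cons] at hn
    rcases h with h | h | h
    · have := (mem_of_edge h).1
      simp only [List.mem_cons] at this
      grind
    · have h1 := hW.ne_center hxw
      have h2 := hW.ne_center_right hxw
      rw [Sym2.eq_iff] at h
      grind
    · have := (mem_of_edge h).2
      simp only [List.mem_append, List.mem_cons] at this
      grind
  constructor
  · refine flipAdj_of_insert (p := w) (q := x) hP ?_ ?_ hnot ?_ ?_
    · exact List.perm_append_comm (l₁ := c0 :: (B1 ++ [w]))
    · rw [hQ', edgeSet_append]; simp
    · rw [hQ', hP', edgeSet_append, edgeSet_append, ← hA]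
      intro e he
      simp only [List.cons_append, Finset.mem_union, Finset.mem_insert] at he ⊢
      tauto
    · exact fun a b h => hxw.symm.segDisj (hP.planeOn.mem _ (mem_of_edge h).1)
        (hP.planeOn.mem _ (mem_of_edge h).2) (ne_of_edge hP.1 h) fun he => hnot (he ▸ h)
  · rw [hQ', hP', defect_append, defect_append, ← hA, if_pos hxw.symm, if_neg hac]
    simp only [List.cons_append]
    ring

end PathLists

section SameSide

variable {S : Finset Pt} {c0 : Pt}

theorem mul_pos_trans {a b c : ℝ} (h1 : 0 < a * b) (h2 : 0 < b * c) : 0 < a * c := by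
  by_contra! hc
  nlinarith [mul_pos h1 h2, mul_self_nonneg b]

theorem edgeSet_subset_append (X Y : List Pt) : edgeSet Y ⊆ edgeSet (X ++ Y) := by
  induction X with
  | nil => simp
  | cons x X ih =>
    refine ih.trans ?_
    rw [List.cons_append]
    cases X ++ Y with
    | nil => simp
    | cons z Z => rw [edgeSet_cons_cons]; exact Finset.subset_insert _ _

theorem PlaneOn.of_append {X Y : List Pt} (h : PlaneOn S (X ++ Y)) : PlaneOn S Y :=
  ⟨(List.nodup_append.1 h.nodup).2.1, fun x hx => h.mem x (List.mem_append_right _ hx),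
    fun a b p q h1 h2 => h.disj a b p q (edgeSet_subset_append X Y h1)
      (edgeSet_subset_append X Y h2)⟩

/-- A path no edge of which joins the two sides of `xy` stays on one side of `xy`. -/
theorem WheelSet.sameSide_of_edges (hW : WheelSet S c0) {x y : Pt} (hx : x ∈ S) (hy : y ∈ S)
    (hxy : x ≠ y) {Y : List Pt} (hY : ∀ p ∈ Y, p ∈ S ∧ p ≠ x ∧ p ≠ y)
    (h : ∀ p q, s(p, q) ∈ edgeSet Y → ¬ sign3 x y p * sign3 x y q < 0) :
    ∀ p ∈ Y, ∀ q ∈ Y, 0 < sign3 x y p * sign3 x y q := by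
  have hne : ∀ p ∈ Y, sign3 x y p ≠ 0 := fun p hp =>
    hW.sign3_ne hx hy (hY p hp).1 hxy (hY p hp).2.1.symm (hY p hp).2.2.symm
  induction Y with
  | nil => simp
  | cons p0 Y ih =>
    have h0 : 0 < sign3 x y p0 * sign3 x y p0 := mul_self_pos.2 (hne p0 (by simp))
    cases Y with
    | nil => simpa using h0
    | cons p1 Y =>
      have ih' := ih (fun p hp => hY p (List.mem_cons_of_mem _ hp))
        (fun p q hpq => h p q (by rw [edgeSet_cons_cons]; exact Finset.mem_insert_of_mem hpq))
        (fun p hp => hne p (List.mem_cons_of_mem _ hp))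
      have h1 : 0 < sign3 x y p0 * sign3 x y p1 :=
        lt_of_le_of_ne (not_lt.1 (h p0 p1 (by simp)))
          (mul_ne_zero (hne p0 (by simp)) (hne p1 (by simp))).symm
      have h2 : ∀ q ∈ p0 :: p1 :: Y, 0 < sign3 x y p0 * sign3 x y q := by
        intro q hq
        rcases List.mem_cons.1 hq with rfl | hq
        · exact h0
        · exact mul_pos_trans h1 (ih' p1 (by simp) q hq)
      exact fun p hp q hq => mul_pos_trans (by rw [mul_comm]; exact h2 p hp) (h2 q hq)

theorem PlaneOn.sameSide (hW : WheelSet S c0) {X Y : List Pt} {x y : Pt}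
    (hP : PlaneOn S (X ++ x :: y :: Y)) (hx : x ≠ c0) (hy : y ≠ c0) :
    ∀ p ∈ Y, ∀ q ∈ Y, 0 < sign3 x y p * sign3 x y q := by
  have hP := hP.of_append
  have hn := hP.nodup
  simp only [List.nodup_cons, List.mem_cons, not_or] at hn
  obtain ⟨⟨hxy, hxY⟩, hyY, -⟩ := hn
  have hY : ∀ p ∈ Y, p ∈ S ∧ p ≠ x ∧ p ≠ y := fun p hp =>
    ⟨hP.mem p (by simp [hp]), by rintro rfl; exact hxY hp, by rintro rfl; exact hyY hp⟩
  have hxS := hP.mem x (by simp)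
  have hyS := hP.mem y (by simp)
  refine hW.sameSide_of_edges hxS hyS hxy hY fun p q hpq hneg => ?_
  obtain ⟨hp, hq⟩ := mem_of_edge hpq
  refine hW.exists_crossing hxS hyS hx hy (hY p hp).1 (hY q hq).1 (hY p hp).2.1 (hY p hp).2.2
    (hY q hq).2.1 (hY q hq).2.2 hneg (hP.disj _ _ _ _ (by simp)
      (edgeSet_subset_append [x, y] Y hpq) ?_)
  intro he
  exact hxY (mem_of_edge (he ▸ hpq)).1

/-- The part of a path behind the center stays on one side of the line through the
two neighbours of the center. -/
theorem PlaneOn.sameSide_center (hW : WheelSet S c0) {X Y : List Pt} {a b : Pt}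
    (hP : PlaneOn S (X ++ a :: c0 :: b :: Y)) :
    ∀ p ∈ Y, ∀ q ∈ Y, 0 < sign3 a b p * sign3 a b q := by
  have hP := hP.of_append
  have hn := hP.nodup
  simp only [List.nodup_cons, List.mem_cons, not_or] at hn
  obtain ⟨⟨hac, hab, haY⟩, ⟨hcb, hcY⟩, hbY, -⟩ := hn
  have hY : ∀ p ∈ Y, p ∈ S ∧ p ≠ a ∧ p ≠ b := fun p hp =>
    ⟨hP.mem p (by simp [hp]), by rintro rfl; exact haY hp, by rintro rfl; exact hbY hp⟩
  have haS := hP.mem a (by simp)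
  have hbS := hP.mem b (by simp)
  have hcS := hP.mem c0 (by simp)
  refine hW.sameSide_of_edges haS hbS hab hY fun p q hpq hneg => ?_
  obtain ⟨hp, hq⟩ := mem_of_edge hpq
  have hpc : p ≠ c0 := by rintro rfl; exact hcY hp
  have hqc : q ≠ c0 := by rintro rfl; exact hcY hq
  obtain ⟨hpS, hpa, hpb⟩ := hY p hp
  obtain ⟨hqS, hqa, hqb⟩ := hY q hq
  have hcr := hW.exists_crossing haS hbS hac (Ne.symm hcb) hpS hqS hpa hpb hqa hqb hneg
  have hpqne : p ≠ q := by
    rintro rfl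
    nlinarith [mul_self_nonneg (sign3 a b p)]
  have hopp := hW.opposite_of_crossing haS hpS hqS hpqne hpa hqa hcr
  have hc0 := hW.sign3_ne hpS hqS hcS hpqne hpc hqc
  have hmem : s(p, q) ∈ edgeSet (a :: c0 :: b :: Y) :=
    edgeSet_subset_append [a, c0, b] Y hpq
  have hd : ∀ v, v = a ∨ v = b → SegDisj p q v c0 := by
    intro v hv
    refine hP.disj _ _ _ _ hmem ?_ fun he => hcY (mem_of_edge (he ▸ hpq)).2
    rcases hv with rfl | rfl
    · simp
    · rw [Sym2.eq_swap]; simp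
  have hkey : sign3 p q a * sign3 p q c0 < 0 ∨ sign3 p q b * sign3 p q c0 < 0 := by
    by_contra! hcon
    have h3 := mul_nonneg hcon.1 hcon.2
    have h4 : 0 < sign3 p q c0 * sign3 p q c0 := mul_self_pos.2 hc0
    nlinarith
  rcases hkey with h | h
  · exact hW.exists_crossing hpS hqS hpc hqc haS hcS hpa.symm hqa.symm hpc.symm hqc.symm h
      (hd a (Or.inl rfl))
  · exact hW.exists_crossing hpS hqS hpc hqc hbS hcS hpb.symm hqb.symm hpc.symm hqc.symm h
      (hd b (Or.inr rfl))

theorem WheelSet.exists_adj_last (hW : WheelSet S c0) {l : List Pt} {w : Pt} (hn : l.Nodup)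
    (hl : ∀ x ∈ S, x ≠ c0 → x ∈ l) (hw : l.getLast? = some w) (hwS : w ∈ S) (hwc : w ≠ c0) :
    ∃ X y z M, l = X ++ y :: z :: (M ++ [w]) ∧ HullAdj S y w := by
  obtain ⟨l', rfl⟩ := List.getLast?_eq_some_iff.1 hw
  obtain ⟨v, hv⟩ : ∃ v, v = l'.getLastD w := ⟨_, rfl⟩
  obtain ⟨y, hyv, hy⟩ := hW.exists_adj_ne hwS hwc v
  have hyl : y ∈ l' := by
    have := hl y hy.mem_right (hW.ne_center_right hy)
    simpa [hy.ne.symm] using this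
  rcases List.eq_nil_or_concat' l' with rfl | ⟨l'', v', rfl⟩
  · simp at hyl
  have hvv : v = v' := by simpa using hv
  have hyl' : y ∈ l'' := by simpa [← hvv, hyv] using hyl
  obtain ⟨X, N, rfl⟩ := List.append_of_mem hyl'
  cases N with
  | nil => exact ⟨X, y, v', [], by simp, hy.symm⟩
  | cons z N => exact ⟨X, y, z, N ++ [v'], by simp, hy.symm⟩

theorem PlaneOn.adj_head (hW : WheelSet S c0) {x y : Pt} {Y : List Pt}
    (hP : PlaneOn S (x :: y :: Y)) (hx : x ≠ c0) (hy : y ≠ c0)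
    (hV : ∀ s ∈ S, s ≠ c0 → s ∈ x :: y :: Y) : HullAdj S x y := by
  have hn := hP.nodup
  simp only [List.nodup_cons, List.mem_cons, not_or] at hn
  refine hW.adj_of_same_side (hP.mem x (by simp)) (hP.mem y (by simp)) hx hn.1.1 ?_
  intro p hp q hq hpc hqc hpx hpy hqx hqy
  have hp' := hV p hp hpc
  have hq' := hV q hq hqc
  exact PlaneOn.sameSide hW (X := []) hP hx hy p (by simpa [hpx, hpy] using hp') q
    (by simpa [hqx, hqy] using hq')

theorem PlaneOn.not_adj_of_adj_last (hW : WheelSet S c0) {X M : List Pt} {x y z w : Pt}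
    (hP : PlaneOn S (X ++ x :: y :: z :: (M ++ [w]))) (hx : x ≠ c0) (hyw : HullAdj S y w) :
    ¬ HullAdj S y z := by
  intro hyz
  have h1 := hP.sameSide hW hx (hW.ne_center hyw) z (by simp) w (by simp)
  have hn := hP.of_append.nodup
  simp only [List.nodup_cons, List.mem_cons, List.mem_append, List.nodup_append, not_or] at hn
  have h2 := hyz.separates hyw (v := x) (by grind) (hP.mem x (by simp)) (by grind) (by grind)
    (by grind)
  rw [sign3_swap_left x y z, sign3_swap_left x y w] at h2
  linarith

/-- A plane path on the hull vertices that uses a non-hull edge has an improving flip. -/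
theorem PlaneOn.exists_improving (hW : WheelSet S c0) {u : List Pt} (hP : PlaneOn S u)
    (hV : ∀ s, s ∈ u ↔ s ∈ S ∧ s ≠ c0) (hu : defect S u ≠ 0) :
    ∃ X y z M w, u = X ++ y :: z :: (M ++ [w]) ∧ HullAdj S y w ∧ ¬ HullAdj S y z := by
  obtain ⟨w, hw⟩ : ∃ w, u.getLast? = some w := by
    cases h : u.getLast? with
    | none => rw [List.getLast?_eq_none_iff] at h; simp [h] at hu
    | some w => exact ⟨w, rfl⟩
  have hwu := (hV w).1 (List.mem_of_getLast? hw)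
  obtain ⟨X, y, z, M, rfl, hyw⟩ := hW.exists_adj_last hP.nodup
    (fun x h1 h2 => (hV x).2 ⟨h1, h2⟩) hw hwu.1 hwu.2
  refine ⟨X, y, z, M, w, rfl, hyw, fun hyz => ?_⟩
  rcases List.eq_nil_or_concat' X with rfl | ⟨X', x, rfl⟩
  · obtain ⟨X1, p, q, Y1, hsplit, hpq⟩ := exists_of_defect_ne hu
    rw [hsplit] at hP hV
    have hPr : PlaneOn S (Y1.reverse ++ q :: p :: X1.reverse) := by
      simpa using hP.reverse
    have hVr : ∀ s, s ∈ Y1.reverse ++ q :: p :: X1.reverse ↔ s ∈ S ∧ s ≠ c0 := by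
      intro s; rw [← hV s]; simp; tauto
    have hpV := (hV p).1 (by simp)
    have hqV := (hV q).1 (by simp)
    cases X1 with
    | nil => exact hpq (hP.adj_head hW hpV.2 hqV.2 fun s h1 h2 => (hV s).2 ⟨h1, h2⟩)
    | cons y' X1 =>
      obtain rfl : y = y' := by simpa using congrArg List.head? hsplit
      rcases List.eq_nil_or_concat' Y1 with rfl | ⟨Y2, w', rfl⟩
      · exact hpq (hPr.adj_head hW hqV.2 hpV.2 fun s h1 h2 => (hVr s).2 ⟨h1, h2⟩).symm
      obtain rfl : w = w' := by
        have := congrArg List.getLast? hsplit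
        rw [show ([] ++ y :: z :: (M ++ [w])) = (y :: z :: M) ++ [w] by simp,
          show (y :: X1 ++ p :: q :: (Y2 ++ [w'])) = (y :: X1 ++ p :: q :: Y2) ++ [w'] by simp,
          List.getLast?_concat, List.getLast?_concat] at this
        exact Option.some.inj this
      have hn := hP.nodup
      have hY := hP.sameSide hW hpV.2 hqV.2
      have hX := hPr.sameSide hW hqV.2 hpV.2
      have hX' : ∀ r ∈ y :: X1, ∀ t ∈ y :: X1, 0 < sign3 p q r * sign3 p q t := by
        intro r hr t ht
        have := hX r (List.mem_reverse.2 hr) t (List.mem_reverse.2 ht)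
        rwa [sign3_swap_left p q r, sign3_swap_left p q t, neg_mul_neg] at this
      simp only [List.nodup_append, List.nodup_cons, List.mem_cons, List.mem_append,
        List.cons_append, not_or] at hn
      have hpqne : p ≠ q := by grind
      have hyS := hyw.mem_left
      have hwS := hyw.mem_right
      have hyw' : 0 < sign3 p q y * sign3 p q w := by
        by_contra! hc
        have h1 := hW.sign3_ne hpV.1 hqV.1 hyS hpqne (by grind) (by grind)
        have h2 := hW.sign3_ne hpV.1 hqV.1 hwS hpqne (by grind) (by grind)
        refine hW.exists_crossing hpV.1 hqV.1 hpV.2 hqV.2 hyS hwS (by grind) (by grind)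
          (by grind) (by grind) (lt_of_le_of_ne hc (mul_ne_zero h1 h2)) ?_
        refine (hyw.segDisj hpV.1 hqV.1 hpqne ?_).symm
        rw [Ne, Sym2.eq_iff]
        grind
      have hall : ∀ r ∈ S, r ≠ c0 → r ≠ p → r ≠ q → 0 < sign3 p q y * sign3 p q r := by
        intro r hr hrc hrp hrq
        have := (hV r).2 ⟨hr, hrc⟩
        rcases List.mem_append.1 this with h | h
        · exact hX' y (by simp) r h
        · have h : r ∈ Y2 ++ [w] := by simpa only [List.mem_cons, hrp, hrq, false_or] using h
          exact mul_pos_trans hyw' (hY w (by simp) r h)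
      refine hpq (hW.adj_of_same_side hpV.1 hqV.1 hpV.2 hpqne ?_)
      intro r hr t ht hrc htc hrp hrq htp htq
      exact mul_pos_trans (by rw [mul_comm]; exact hall r hr hrc hrp hrq) (hall t ht htc htp htq)
  · rw [List.append_assoc] at hP
    exact PlaneOn.not_adj_of_adj_last hW hP ((hV x).1 (by simp)).2 hyw hyz

/-- A plane path with the center in its interior has an improving flip. -/
theorem IsPlanePath.exists_improving (hW : WheelSet S c0) {A B : List Pt}
    (hP : IsPlanePath S (A ++ c0 :: B)) (hA : A ≠ []) (hB : B ≠ []) :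
    ∃ P', FlipAdj S (A ++ c0 :: B) P' ∧ defect S P' + 1 = defect S (A ++ c0 :: B) := by
  obtain ⟨w, hw⟩ : ∃ w, B.getLast? = some w := by
    cases h : B.getLast? with
    | none => exact absurd (List.getLast?_eq_none_iff.1 h) hB
    | some w => exact ⟨w, rfl⟩
  have hwP : (A ++ c0 :: B).getLast? = some w := by
    obtain ⟨B', rfl⟩ := List.getLast?_eq_some_iff.1 hw
    rw [← List.cons_append, ← List.append_assoc, List.getLast?_concat]
  have hn := hP.1
  have hwB := List.mem_of_getLast? hw
  have hwc : w ≠ c0 := by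
    rintro rfl
    simp only [List.nodup_append, List.nodup_cons] at hn
    exact hn.2.1.1 hwB
  obtain ⟨X, y, z, M, hsplit, hyw⟩ := hW.exists_adj_last hn (fun x hx _ => hP.mem_iff.2 hx) hwP
    (hP.mem_iff.1 (by simp [hwB])) hwc
  by_cases hyz : HullAdj S y z
  · rcases List.eq_nil_or_concat' X with rfl | ⟨X', x, rfl⟩
    · have hAy : A.head? = some y := by
        cases A with
        | nil => exact absurd rfl hA
        | cons a A => simpa using congrArg List.head? hsplit
      exact ⟨_, flipAdj_rotate hW hP hAy hw hyw⟩
    · rw [List.append_assoc] at hsplit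
      exfalso
      by_cases hxc : x = c0
      · subst hxc
        rcases List.eq_nil_or_concat' X' with rfl | ⟨X'', a, rfl⟩
        · cases A with
          | nil => exact hA rfl
          | cons a A =>
            have := congrArg List.head? hsplit
            simp at this
            subst this
            simp at hn
        · have hPl := hP.planeOn
          rw [hsplit] at hPl hn
          rw [List.append_assoc] at hPl
          have h1 := hPl.sameSide_center hW z (by simp) w (by simp)
          simp only [List.nodup_cons, List.mem_cons, List.mem_append, List.nodup_append,
            not_or] at hn
          have h2 := hyz.separates hyw (v := a) (by grind) (hPl.mem a (by simp)) (by grind)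
            (by grind) (by grind)
          rw [sign3_swap_left a y z, sign3_swap_left a y w] at h2
          linarith
      · have hPl := hP.planeOn
        rw [hsplit] at hPl
        exact hPl.not_adj_of_adj_last hW hxc hyw hyz
  · rw [hsplit] at hP ⊢
    exact ⟨_, flipAdj_suffix_hull hP rfl (by simp [List.getLast?_cons]) hyw hyz⟩

end SameSide

section FlipSequences

variable {S : Finset Pt} {c0 : Pt}

/-- `Q` is reached from `P` by `k` flips, up to reversal of the paths. -/
inductive Reach (S : Finset Pt) : ℕ → List Pt → List Pt → Prop
  | refl {P Q : List Pt} : IsPlanePath S P → edgeSet P = edgeSet Q → IsPlanePath S Q →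
      Reach S 0 P Q
  | step {k : ℕ} {P P' Q : List Pt} : FlipAdj S P P' → Reach S k P' Q → Reach S (k + 1) P Q

theorem FlipAdj.symm {P Q : List Pt} (h : FlipAdj S P Q) : FlipAdj S Q P := by
  obtain ⟨h1, h2, e, f, h3, h4, h5, h6⟩ := h
  exact ⟨h2, h1, f, e, h3.symm, h5, h4, h6.symm⟩

theorem Reach.congr_left {k : ℕ} {P P' Q : List Pt} (h : Reach S k P Q)
    (hP' : IsPlanePath S P') (he : edgeSet P' = edgeSet P) : Reach S k P' Q := by
  cases h with
  | refl h1 h2 h3 => exact .refl hP' (he.trans h2) h3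
  | step h1 h2 =>
    obtain ⟨-, h3, e, f, h4, h5, h6, h7⟩ := h1
    exact .step ⟨hP', h3, e, f, h4, he ▸ h5, h6, he ▸ h7⟩ h2

theorem Reach.trans {j k : ℕ} {P Q R : List Pt} (h : Reach S j P Q) (h' : Reach S k Q R) :
    Reach S (j + k) P R := by
  induction h with
  | refl h1 h2 h3 => rw [zero_add]; exact h'.congr_left h1 h2
  | step h1 _ ih => rw [Nat.add_right_comm]; exact .step h1 (ih h')

theorem Reach.symm {k : ℕ} {P Q : List Pt} (h : Reach S k P Q) : Reach S k Q P := by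
  induction h with
  | refl h1 h2 h3 => exact .refl h3 h2.symm h1
  | step h1 _ ih => exact ih.trans (.step h1.symm (.refl h1.1 rfl h1.1))

theorem Reach.flipSeq {k : ℕ} {P Q : List Pt} (h : Reach S k P Q) :
    FlipSeq S (fun _ => True) k P Q := by
  induction h with
  | refl h1 h2 h3 => exact ⟨fun _ => _, rfl, h2, fun _ _ => ⟨h1, trivial⟩, by simp⟩
  | @step k P P' Q h1 _ ih =>
    obtain ⟨f, rfl, h2, h3, h4⟩ := ih
    refine ⟨fun i => Nat.casesOn i P f, rfl, h2, ?_, ?_⟩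
    · rintro (_ | i) hi
      · exact ⟨h1.1, trivial⟩
      · exact h3 i (by omega)
    · rintro (_ | i) hi
      · exact h1
      · exact h4 i (by omega)

/-- `Q` is reached from `P` by at most `d` flips, up to reversal of the paths. -/
def Within (S : Finset Pt) (d : ℕ) (P Q : List Pt) : Prop := ∃ k ≤ d, Reach S k P Q

theorem IsPlanePath.within_refl {P : List Pt} (h : IsPlanePath S P) : Within S 0 P P :=
  ⟨0, le_rfl, .refl h rfl h⟩

theorem IsPlanePath.within_reverse {P : List Pt} (h : IsPlanePath S P) :
    Within S 0 P P.reverse :=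
  ⟨0, le_rfl, .refl h (edgeSet_reverse P).symm h.reverse⟩

theorem FlipAdj.within {P Q : List Pt} (h : FlipAdj S P Q) : Within S 1 P Q :=
  ⟨1, le_rfl, .step h (.refl h.2.1 rfl h.2.1)⟩

theorem Within.trans {d e f : ℕ} {P Q R : List Pt} (h : Within S d P Q) (h' : Within S e Q R)
    (hf : d + e ≤ f) : Within S f P R := by
  obtain ⟨j, hj, h1⟩ := h
  obtain ⟨k, hk, h2⟩ := h'
  exact ⟨j + k, by omega, h1.trans h2⟩

theorem Within.mono {d e : ℕ} {P Q : List Pt} (h : Within S d P Q) (hde : d ≤ e) :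
    Within S e P Q := by
  obtain ⟨k, hk, h⟩ := h
  exact ⟨k, hk.trans hde, h⟩

theorem Within.symm {d : ℕ} {P Q : List Pt} (h : Within S d P Q) : Within S d Q P := by
  obtain ⟨k, hk, h⟩ := h
  exact ⟨k, hk, h.symm⟩

end FlipSequences

section Reduction

variable {S : Finset Pt} {c0 : Pt}

/-- The path starting at the center and continuing along `u` is a canonical path: apart from
its first edge it consists of hull edges. -/
structure EndCanonical (S : Finset Pt) (c0 : Pt) (u : List Pt) : Prop where
  plane : IsPlanePath S (c0 :: u)
  chain : u.IsChain (HullAdj S)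

theorem WheelSet.not_adj_center (hW : WheelSet S c0) (x : Pt) : ¬ HullAdj S c0 x :=
  fun h => hW.ne_center h rfl

theorem WheelSet.not_center_adj (hW : WheelSet S c0) (x : Pt) : ¬ HullAdj S x c0 :=
  fun h => hW.ne_center_right h rfl

theorem IsPlanePath.mem_tail_iff {u : List Pt} (h : IsPlanePath S (c0 :: u)) {x : Pt} :
    x ∈ u ↔ x ∈ S ∧ x ≠ c0 := by
  rw [← h.mem_iff, List.mem_cons]
  have := (List.nodup_cons.1 h.1).1
  constructor
  · intro hx
    exact ⟨Or.inr hx, by rintro rfl; exact this hx⟩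
  · rintro ⟨h1 | h1, h2⟩
    · exact absurd h1 h2
    · exact h1

theorem IsPlanePath.planeOn_tail {u : List Pt} (h : IsPlanePath S (c0 :: u)) : PlaneOn S u :=
  PlaneOn.of_append (X := [c0]) h.planeOn

theorem defect_center_cons (hW : WheelSet S c0) {u : List Pt} (hu : u ≠ []) :
    defect S (c0 :: u) = 1 + defect S u := by
  cases u with
  | nil => exact absurd rfl hu
  | cons x u => rw [defect_cons_cons, if_neg (hW.not_adj_center x)]

theorem IsPlanePath.tail_ne_nil (hW : WheelSet S c0) {u : List Pt}
    (h : IsPlanePath S (c0 :: u)) : u ≠ [] := by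
  rintro rfl
  have h1 := h.length
  have h2 := hW.2.1
  simp at h1
  omega

theorem IsPlanePath.one_le_defect (hW : WheelSet S c0) {P : List Pt} (hP : IsPlanePath S P) :
    1 ≤ defect S P := by
  obtain ⟨A, B, rfl⟩ := List.append_of_mem (hP.mem_iff.2 hW.2.2.1.1)
  cases B with
  | cons b B =>
    rw [defect_append, if_neg (hW.not_adj_center b)]
    omega
  | nil =>
    have h := hP.reverse
    rw [← defect_reverse]
    simp only [List.reverse_append, List.reverse_cons, List.reverse_nil, List.nil_append,
      List.singleton_append] at h ⊢
    rw [defect_center_cons hW (h.tail_ne_nil hW)]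
    omega

/-- Every plane path reaches a canonical path that ends in the center by improving flips. -/
theorem IsPlanePath.exists_endCanonical (hW : WheelSet S c0) {P : List Pt}
    (hP : IsPlanePath S P) :
    ∃ u, EndCanonical S c0 u ∧ Within S (defect S P - 1) P (c0 :: u) := by
  induction hd : defect S P using Nat.strong_induction_on generalizing P with
  | _ d ih =>
  have step : ∀ {P P' : List Pt}, FlipAdj S P P' → defect S P' + 1 = defect S P →
      defect S P = d → ∃ u, EndCanonical S c0 u ∧ Within S (d - 1) P (c0 :: u) := by
    intro P P' h1 h2 h3
    obtain ⟨u, h4, h5⟩ := ih (defect S P') (by omega) h1.2.1 rfl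
    have := h1.2.1.one_le_defect hW
    exact ⟨u, h4, h1.within.trans h5 (by omega)⟩
  have head : ∀ {u : List Pt}, IsPlanePath S (c0 :: u) → defect S (c0 :: u) = d →
      ∃ v, EndCanonical S c0 v ∧ Within S (d - 1) (c0 :: u) (c0 :: v) := by
    intro u hu hd
    by_cases h0 : defect S u = 0
    · exact ⟨u, ⟨hu, isChain_of_defect h0⟩, hu.within_refl.mono (Nat.zero_le _)⟩
    · obtain ⟨X, y, z, M, w, rfl, hyw, hyz⟩ :=
        hu.planeOn_tail.exists_improving hW (fun s => hu.mem_tail_iff) h0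
      obtain ⟨h1, h2⟩ := flipAdj_suffix_hull (X := c0 :: X) (T := z :: (M ++ [w])) hu rfl
        (by simp [List.getLast?_cons]) hyw hyz
      exact step h1 h2 hd
  obtain ⟨A, B, rfl⟩ := List.append_of_mem (hP.mem_iff.2 hW.2.2.1.1)
  by_cases hA : A = []
  · subst hA
    exact head hP hd
  by_cases hB : B = []
  · subst hB
    have hr := hP.reverse
    rw [← defect_reverse] at hd
    have he : (A ++ [c0]).reverse = c0 :: A.reverse := by simp
    rw [he] at hd hr
    obtain ⟨v, h1, h2⟩ := head hr hd
    exact ⟨v, h1, hP.within_reverse.trans (he ▸ h2) (by omega)⟩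
  · obtain ⟨P', h1, h2⟩ := hP.exists_improving hW hA hB
    exact step h1 h2 hd

/-- The hull edges of a plane path along all hull vertices close up to the hull polygon. -/
theorem PlaneOn.exists_closing (hW : WheelSet S c0) {u : List Pt} (hP : PlaneOn S u)
    (hV : ∀ s, s ∈ u ↔ s ∈ S ∧ s ≠ c0) (hu : u ≠ []) (hc : u.IsChain (HullAdj S)) :
    ∃ y z M w, u = y :: z :: (M ++ [w]) ∧ HullAdj S y w ∧ HullAdj S y z := by
  have hw := List.getLast?_eq_some_getLast hu
  have hwu := (hV _).1 (List.getLast_mem hu)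
  obtain ⟨X, y, z, M, he, hyw⟩ := hW.exists_adj_last hP.nodup
    (fun x h1 h2 => (hV x).2 ⟨h1, h2⟩) hw hwu.1 hwu.2
  generalize u.getLast hu = w at *
  subst he
  have hyz : HullAdj S y z := (List.isChain_cons_cons.1 (List.isChain_append.1 hc).2.1).1
  rcases List.eq_nil_or_concat' X with rfl | ⟨X', x, rfl⟩
  · exact ⟨y, z, M, w, rfl, hyw, hyz⟩
  · rw [List.append_assoc] at hP
    exact absurd hyz (PlaneOn.not_adj_of_adj_last hW hP ((hV x).1 (by simp)).2 hyw)

/-- Short-cutting the center of a path whose center has adjacent hull neighbours. -/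
theorem IsPlanePath.planeOn_shortcut {A B : List Pt} {a b : Pt}
    (hP : IsPlanePath S (A ++ a :: c0 :: b :: B)) (hab : HullAdj S a b) :
    PlaneOn S (A ++ a :: b :: B) ∧ ∀ s, s ∈ A ++ a :: b :: B ↔ s ∈ S ∧ s ≠ c0 := by
  have hn := hP.1
  have hsub : (A ++ a :: b :: B).Sublist (A ++ a :: c0 :: b :: B) := by simp
  have hnu := hn.sublist hsub
  have hedge : ∀ e ∈ edgeSet (A ++ a :: b :: B),
      e = s(a, b) ∨ e ∈ edgeSet (A ++ a :: c0 :: b :: B) := by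
    intro e he
    rw [edgeSet_append] at he
    rw [edgeSet_append, edgeSet_cons_cons]
    simp only [Finset.mem_union, Finset.mem_insert] at he ⊢
    tauto
  refine ⟨⟨hnu, fun x hx => hP.planeOn.mem x (hsub.subset hx), ?_⟩, fun s => ?_⟩
  · intro p q p' q' h1 h2 hne
    have side : ∀ p q, s(p, q) ∈ edgeSet (A ++ a :: b :: B) → s(p, q) ≠ s(a, b) →
        SegDisj a b p q := fun p q h hne => hab.segDisj
      (hP.planeOn.mem p (hsub.subset (mem_of_edge h).1))
      (hP.planeOn.mem q (hsub.subset (mem_of_edge h).2)) (ne_of_edge hnu h) hne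
    rcases hedge _ h1 with h3 | h3
    · exact segDisj_congr (side p' q' h2 fun h => hne (h3.trans h.symm)) h3.symm rfl
    rcases hedge _ h2 with h4 | h4
    · exact (segDisj_congr (side p q h1 fun h => hne (h.trans h4.symm)) h4.symm rfl).symm
    · exact hP.planeOn.disj p q p' q' h3 h4 hne
  · rw [← hP.mem_iff]
    simp only [List.nodup_append, List.nodup_cons, List.mem_append, List.mem_cons] at hn ⊢
    grind

/-- If the center lies between two adjacent hull vertices, then improving flips lead to
canonical paths ending in the center of both orientations. -/
theorem IsPlanePath.exists_endCanonical_both (hW : WheelSet S c0) {A B : List Pt} {a b : Pt}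
    (hP : IsPlanePath S (A ++ a :: c0 :: b :: B)) (hab : HullAdj S a b) :
    ∃ u, EndCanonical S c0 u ∧
      Within S (defect S (A ++ a :: c0 :: b :: B) - 1) (A ++ a :: c0 :: b :: B) (c0 :: u) ∧
      Within S (defect S (A ++ a :: c0 :: b :: B) - 1) (A ++ a :: c0 :: b :: B)
        (c0 :: u.reverse) := by
  induction hd : defect S (A ++ a :: c0 :: b :: B) using Nat.strong_induction_on
    generalizing A B a b with
  | _ d ih =>
  have step : ∀ {A' B' : List Pt} {a' b' : Pt}, HullAdj S a' b' →
      FlipAdj S (A ++ a :: c0 :: b :: B) (A' ++ a' :: c0 :: b' :: B') →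
      defect S (A' ++ a' :: c0 :: b' :: B') + 1 = defect S (A ++ a :: c0 :: b :: B) →
      ∃ u, EndCanonical S c0 u ∧
        Within S (d - 1) (A ++ a :: c0 :: b :: B) (c0 :: u) ∧
        Within S (d - 1) (A ++ a :: c0 :: b :: B) (c0 :: u.reverse) := by
    intro A' B' a' b' hab' h1 h2
    obtain ⟨u, h3, h4, h5⟩ := ih _ (by omega) h1.2.1 hab' rfl
    have := h1.2.1.one_le_defect hW
    exact ⟨u, h3, h1.within.trans h4 (by omega), h1.within.trans h5 (by omega)⟩
  obtain ⟨hu, hV⟩ := hP.planeOn_shortcut hab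
  by_cases h0 : defect S (A ++ a :: b :: B) = 0
  · have h2 : defect S (A ++ a :: c0 :: b :: B) = 2 := by
      rw [defect_append, if_pos hab] at h0
      rw [defect_append, if_neg (hW.not_center_adj a), defect_cons_cons,
        if_neg (hW.not_adj_center b)]
      omega
    obtain ⟨y, z, M, w, he, hyw, -⟩ := hu.exists_closing hW hV (by simp) (isChain_of_defect h0)
    have hy : (A ++ [a]).head? = some y := by
      have := congrArg List.head? he
      rw [show A ++ a :: b :: B = (A ++ [a]) ++ b :: B by simp,
        List.head?_append_of_ne_nil _ (by simp)] at this
      simpa using this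
    have hw : (b :: B).getLast? = some w := by
      have := congrArg List.getLast? he
      rw [show A ++ a :: b :: B = (A ++ [a]) ++ b :: B by simp,
        List.getLast?_append_of_ne_nil _ (by simp)] at this
      simpa [List.getLast?_cons] using this
    have hP1 : IsPlanePath S ((A ++ [a]) ++ c0 :: b :: B) := by simpa using hP
    have hP2 : IsPlanePath S ((b :: B).reverse ++ c0 :: (A ++ [a]).reverse) := by
      simpa using hP.reverse
    obtain ⟨h3, h4⟩ := flipAdj_rotate hW hP1 hy hw hyw
    obtain ⟨h5, h6⟩ := flipAdj_rotate hW hP2 (by rw [List.head?_reverse, hw])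
      (by rw [List.getLast?_reverse, hy]) hyw.symm
    have e1 : (A ++ [a]) ++ c0 :: b :: B = A ++ a :: c0 :: b :: B := by simp
    have e2 : (b :: B).reverse ++ c0 :: (A ++ [a]).reverse =
        (A ++ a :: c0 :: b :: B).reverse := by simp
    have e3 : (A ++ [a]).reverse ++ (b :: B).reverse = (b :: B ++ (A ++ [a])).reverse := by simp
    rw [e1] at h3 h4
    rw [e2, e3] at h5 h6
    rw [defect_reverse] at h6
    rw [defect_center_cons hW (by simp)] at h4 h6
    refine ⟨b :: B ++ (A ++ [a]), ⟨h3.2.1, isChain_of_defect (by omega)⟩, h3.within.mono (by omega),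
      hP.within_reverse.trans h5.within (by omega)⟩
  · obtain ⟨X, y, z, M, w, he, hyw, hyz⟩ := hu.exists_improving hW hV h0
    have he' : (A ++ [a]) ++ b :: B = (X ++ [y]) ++ z :: (M ++ [w]) := by simpa using he
    have hne : ¬ (A ++ [a] = X ++ [y] ∧ b :: B = z :: (M ++ [w])) := by
      rintro ⟨h1, h2⟩
      have h3 := (List.append_inj' h1 rfl).2
      simp only [List.cons.injEq] at h2 h3
      exact hyz (h3.1 ▸ h2.1 ▸ hab)
    rcases List.append_eq_append_iff.1 he' with ⟨D, h1, h2⟩ | ⟨D, h1, h2⟩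
    · rcases List.eq_nil_or_concat' D with rfl | ⟨E, y', rfl⟩
      · exact absurd ⟨by simpa using h1.symm, by simpa using h2⟩ hne
      rw [← List.append_assoc] at h1
      obtain ⟨h3, h4⟩ := List.append_inj' h1 rfl
      obtain rfl : y = y' := by simpa using h4
      have hT : A ++ a :: c0 :: b :: B = (A ++ a :: c0 :: E) ++ y :: z :: (M ++ [w]) := by
        rw [h2]; simp
      obtain ⟨b', D', hb⟩ : ∃ b' D', E ++ [y] = b' :: D' := by
        cases E with
        | nil => exact ⟨y, [], rfl⟩
        | cons e E => exact ⟨e, E ++ [y], rfl⟩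
      obtain rfl : b = b' := by rw [hb] at h2; simpa using congrArg List.head? h2
      have hP' := hP
      rw [hT] at hP'
      obtain ⟨h5, h6⟩ := flipAdj_suffix_hull hP' rfl (by simp [List.getLast?_cons]) hyw hyz
      have hQ : (A ++ a :: c0 :: E) ++ y :: (z :: (M ++ [w])).reverse =
          A ++ a :: c0 :: b :: (D' ++ (z :: (M ++ [w])).reverse) := by
        rw [← List.cons_append (a := b), ← hb]; simp
      rw [hQ, ← hT] at h5 h6
      exact step hab h5 h6
    · rcases List.eq_nil_or_concat' D with rfl | ⟨E, a', rfl⟩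
      · exact absurd ⟨by simpa using h1, by simpa using h2.symm⟩ hne
      rw [← List.append_assoc] at h1
      obtain ⟨h3, h4⟩ := List.append_inj' h1 rfl
      obtain rfl : a = a' := by simpa using h4
      have hT : A ++ a :: c0 :: b :: B = X ++ y :: (E ++ a :: c0 :: b :: B) := by
        rw [h3]; simp
      have hz : (E ++ a :: c0 :: b :: B).head? = some z := by
        have := congrArg List.head? h2
        cases E <;> simpa using this.symm
      have hw : (E ++ a :: c0 :: b :: B).getLast? = some w := by
        have := congrArg List.getLast? h2
        rw [List.getLast?_append_of_ne_nil _ (by simp), ← List.cons_append,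
          List.getLast?_concat] at this
        rw [show E ++ a :: c0 :: b :: B = (E ++ [a, c0]) ++ b :: B by simp,
          List.getLast?_append_of_ne_nil _ (by simp), this]
      have hP' := hP
      rw [hT] at hP'
      obtain ⟨h5, h6⟩ := flipAdj_suffix_hull hP' hz hw hyw hyz
      have hQ : X ++ y :: (E ++ a :: c0 :: b :: B).reverse =
          (X ++ y :: B.reverse) ++ b :: c0 :: a :: E.reverse := by simp
      rw [hQ, ← hT] at h5 h6
      exact step hab.symm h5 h6

end Reduction

section CanonicalPaths

variable {S : Finset Pt} {c0 : Pt}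

theorem adj_of_edge {u : List Pt} (hu : u.IsChain (HullAdj S)) {p q : Pt}
    (h : s(p, q) ∈ edgeSet u) : HullAdj S p q := by
  induction u with
  | nil => simp at h
  | cons x u ih =>
    cases u with
    | nil => simp at h
    | cons y u =>
      rw [List.isChain_cons_cons] at hu
      rw [edgeSet_cons_cons, Finset.mem_insert, Sym2.eq_iff] at h
      rcases h with (⟨rfl, rfl⟩ | ⟨rfl, rfl⟩) | h
      · exact hu.1
      · exact hu.1.symm
      · exact ih hu.2 h

theorem EndCanonical.exists_closing (hW : WheelSet S c0) {u : List Pt}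
    (hu : EndCanonical S c0 u) :
    ∃ y z M w, u = y :: z :: (M ++ [w]) ∧ HullAdj S y w ∧ HullAdj S y z :=
  hu.plane.planeOn_tail.exists_closing hW (fun _ => hu.plane.mem_tail_iff)
    (hu.plane.tail_ne_nil hW) hu.chain

/-- Canonical paths ending in the center that traverse the hull in the same direction are
at distance at most two. -/
theorem EndCanonical.within_of_isRotated (hW : WheelSet S c0) {u v : List Pt}
    (hu : EndCanonical S c0 u) (h : u ~r v) : Within S 2 (c0 :: u) (c0 :: v) := by
  obtain ⟨n, hn, rfl⟩ := List.isRotated_iff_mod.1 h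
  rw [List.rotate_eq_drop_append_take hn]
  obtain ⟨x, z, M, w, he, hxw, -⟩ := hu.exists_closing hW
  have hsplit := List.take_append_drop n u
  generalize List.take n u = X at *
  generalize List.drop n u = Y at *
  subst hsplit
  cases X with
  | nil => simpa using hu.plane.within_refl.mono (Nat.zero_le 2)
  | cons x' X =>
  cases Y with
  | nil => simpa using hu.plane.within_refl.mono (Nat.zero_le 2)
  | cons y Y =>
  obtain rfl : x' = x := by simpa using congrArg List.head? he
  have hw : (y :: Y).getLast? = some w := by
    have := congrArg List.getLast? he
    rw [List.getLast?_append_of_ne_nil _ (by simp)] at this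
    simpa [List.getLast?_cons] using this
  have hn := hu.plane.1
  simp only [List.nodup_cons, List.nodup_append, List.mem_append, List.mem_cons,
    List.cons_append, not_or] at hn
  have hmem : ∀ s ∈ c0 :: (x' :: X ++ y :: Y), s ∈ S := fun s => hu.plane.mem_iff.1
  obtain ⟨a, ha⟩ : ∃ a, (x' :: X).getLast? = some a := ⟨_, List.getLast?_cons⟩
  have e1 : (c0 :: (x' :: X ++ y :: Y)).reverse =
      Y.reverse ++ y :: ((x' :: X).reverse ++ [c0]) := by simp
  have e2 : Y.reverse ++ y :: ((x' :: X).reverse ++ [c0]).reverse =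
      (X.reverse ++ x' :: (c0 :: y :: Y)).reverse := by simp
  have e3 : X.reverse ++ x' :: (c0 :: y :: Y).reverse =
      (c0 :: (y :: Y ++ x' :: X)).reverse := by simp
  have hac : a ≠ c0 := by
    rintro rfl
    have := List.mem_of_getLast? ha
    simp only [List.mem_cons] at this
    tauto
  have f1 : FlipAdj S (c0 :: (x' :: X ++ y :: Y)).reverse
      (X.reverse ++ x' :: (c0 :: y :: Y)).reverse := by
    rw [← e2]
    have hr := hu.plane.reverse
    rw [e1] at hr ⊢
    refine flipAdj_suffix hr (z := a) (w := c0) ?_ (List.getLast?_concat ..) hac ?_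
    · rw [List.head?_append_of_ne_nil _ (by simp), List.head?_reverse, ha]
    · intro p q h hne
      rw [← e1, edgeSet_reverse, List.cons_append, edgeSet_cons_cons, Finset.mem_insert] at h
      rcases h with h | h
      · exact segDisj_congr (hW.segDisj_of_common (hmem c0 (by simp)) (hmem y (by simp))
          (hmem x' (by simp)) (by grind) (by grind) (by grind)) Sym2.eq_swap h.symm
      · exact ((adj_of_edge hu.chain h).segDisj (hmem y (by simp)) (hmem c0 (by simp))
          (by grind) hne.symm).symm
  have f2 : FlipAdj S (X.reverse ++ x' :: (c0 :: y :: Y))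
      (c0 :: (y :: Y ++ x' :: X)).reverse := by
    rw [← e3]
    have hr := f1.2.1.reverse
    rw [List.reverse_reverse] at hr
    refine flipAdj_suffix hr (z := c0) (w := w) rfl (by simpa [List.getLast?_cons] using hw)
      (hW.ne_center_right hxw).symm ?_
    intro p q h hne
    exact hxw.segDisj (hr.planeOn.mem _ (mem_of_edge h).1) (hr.planeOn.mem _ (mem_of_edge h).2)
      (ne_of_edge hr.1 h) hne
  have g1 := hu.plane.within_reverse.trans f1.within le_rfl
  have g2 := g1.trans f1.2.1.within_reverse le_rfl
  rw [List.reverse_reverse] at g2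
  have g3 := (g2.trans f2.within le_rfl).trans f2.2.1.within_reverse le_rfl
  rw [List.reverse_reverse] at g3
  exact g3

/-- The direction in which a canonical path traverses the hull is changed by one flip. -/
theorem EndCanonical.exists_flip (hW : WheelSet S c0) {u : List Pt} (hu : EndCanonical S c0 u) :
    ∃ v, EndCanonical S c0 v ∧ FlipAdj S (c0 :: u) (c0 :: v) ∧ v ~r u.reverse := by
  obtain ⟨y, z, M, w, rfl, hyw, hyz⟩ := hu.exists_closing hW
  have hn := hu.plane.1
  have hzw : z ≠ w := by
    simp only [List.nodup_cons, List.mem_append, List.mem_cons] at hn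
    grind
  have hf : FlipAdj S (c0 :: y :: z :: (M ++ [w])) (c0 :: y :: (z :: (M ++ [w])).reverse) :=
    flipAdj_suffix (X := [c0]) hu.plane rfl (by simp [List.getLast?_cons]) hzw
      fun p q h hne => hyw.segDisj (hu.plane.planeOn.mem _ (mem_of_edge h).1)
        (hu.plane.planeOn.mem _ (mem_of_edge h).2) (ne_of_edge hn h) hne
  refine ⟨_, ⟨hf.2.1, ?_⟩, hf, ?_⟩
  · have hc := (List.isChain_cons_cons.1 hu.chain).2
    have hr : (z :: (M ++ [w])).reverse.IsChain (HullAdj S) :=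
      List.isChain_reverse.2 (hc.imp fun _ _ h => h.symm)
    rw [show (z :: (M ++ [w])).reverse = w :: (M.reverse ++ [z]) by simp] at hr ⊢
    exact List.isChain_cons_cons.2 ⟨hyw, hr⟩
  · rw [List.reverse_cons (a := y)]
    exact List.isRotated_append (l := [y])

theorem isChain_hullSucc_or_reverse {u : List Pt} (hn : u.Nodup) (hc : u.IsChain (HullAdj S)) :
    u.IsChain (HullSucc S) ∨ u.reverse.IsChain (HullSucc S) := by
  rw [List.isChain_reverse]
  induction u with
  | nil => simp
  | cons x u ih =>
    cases u with
    | nil => simp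
    | cons y u =>
      rw [List.isChain_cons_cons] at hc
      cases u with
      | nil => simpa [HullAdj] using hc
      | cons z u =>
        have hxz : x ≠ z := by
          simp only [List.nodup_cons, List.mem_cons] at hn
          grind
        rcases ih hn.of_cons hc.2 with h | h
        · refine Or.inl (List.isChain_cons_cons.2 ⟨hc.1.resolve_right fun h' => hxz ?_, h⟩)
          exact h'.right_unique (List.isChain_cons_cons.1 h).1
        · refine Or.inr (List.isChain_cons_cons.2 ⟨hc.1.resolve_left fun h' => hxz ?_, h⟩)
          exact h'.left_unique (List.isChain_cons_cons.1 h).1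

theorem eq_of_isChain_hullSucc {x : Pt} {l l' : List Pt} (hl : (x :: l).IsChain (HullSucc S))
    (hl' : (x :: l').IsChain (HullSucc S)) (h : l.length = l'.length) : l = l' := by
  induction l generalizing x l' with
  | nil => exact (List.length_eq_zero_iff.1 h.symm).symm
  | cons y l ih =>
    cases l' with
    | nil => simp at h
    | cons y' l' =>
      rw [List.isChain_cons_cons] at hl hl'
      obtain rfl := hl.1.right_unique hl'.1
      rw [ih hl.2 hl'.2 (by simpa using h)]

theorem EndCanonical.isRotated_of_isChain (hW : WheelSet S c0) {u v : List Pt}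
    (hu : EndCanonical S c0 u) (hv : EndCanonical S c0 v) (hu' : u.IsChain (HullSucc S))
    (hv' : v.IsChain (HullSucc S)) : u ~r v := by
  cases v with
  | nil => exact absurd rfl (hv.plane.tail_ne_nil hW)
  | cons x v =>
  have hx : x ∈ u := hu.plane.mem_tail_iff.2 (hv.plane.mem_tail_iff.1 (by simp))
  have hlen : u.length = (x :: v).length := by
    have h1 := hu.plane.length
    have h2 := hv.plane.length
    simp only [List.length_cons] at h1 h2 ⊢
    omega
  obtain ⟨y, z, M, w, he, hyw, hyz⟩ := hu.exists_closing hW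
  have hwy : HullSucc S w y := by
    refine hyw.resolve_left fun h => ?_
    have hn := hu.plane.1.of_cons
    rw [he] at hu' hn
    have := h.right_unique (List.isChain_cons_cons.1 hu').1
    subst this
    simp at hn
  obtain ⟨X, Y, rfl⟩ := List.append_of_mem hx
  have hrot : X ++ x :: Y ~r x :: Y ++ X := List.isRotated_append
  have hc : (x :: Y ++ X).IsChain (HullSucc S) := by
    obtain ⟨h1, h2, -⟩ := List.isChain_append.1 hu'
    refine List.isChain_append.2 ⟨h2, h1, fun p hp q hq => ?_⟩
    cases X with
    | nil => simp at hq
    | cons x' X =>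
      obtain rfl : x' = y := by simpa using congrArg List.head? he
      obtain rfl : x' = q := by simpa using hq
      have := congrArg List.getLast? he
      rw [List.getLast?_append_of_ne_nil _ (by simp), Option.mem_def.1 hp,
        ← List.cons_append, ← List.cons_append, List.getLast?_concat] at this
      rw [Option.some.inj this]
      exact hwy
  rw [eq_of_isChain_hullSucc hv' hc (by simp at hlen ⊢; omega)]
  exact hrot

theorem Reach.plane_left {k : ℕ} {P Q : List Pt} (h : Reach S k P Q) : IsPlanePath S P := by
  cases h with
  | refl h1 _ _ => exact h1
  | step h1 _ => exact h1.1

theorem EndCanonical.reverse (hW : WheelSet S c0) {u : List Pt} (hu : EndCanonical S c0 u) :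
    EndCanonical S c0 u.reverse := by
  obtain ⟨v, hv, -, h⟩ := hu.exists_flip hW
  obtain ⟨k, -, hk⟩ := hv.within_of_isRotated hW h
  exact ⟨hk.symm.plane_left, List.isChain_reverse.2 (hu.chain.imp fun _ _ h => h.symm)⟩

theorem EndCanonical.isRotated_or_reverse (hW : WheelSet S c0) {u v : List Pt}
    (hu : EndCanonical S c0 u) (hv : EndCanonical S c0 v) : u ~r v ∨ u.reverse ~r v := by
  rcases isChain_hullSucc_or_reverse hu.plane.1.of_cons hu.chain with h1 | h1 <;>
    rcases isChain_hullSucc_or_reverse hv.plane.1.of_cons hv.chain with h2 | h2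
  · exact Or.inl (hu.isRotated_of_isChain hW hv h1 h2)
  · have := hu.isRotated_of_isChain hW (hv.reverse hW) h1 h2
    exact Or.inr (by simpa using this.reverse)
  · exact Or.inr ((hu.reverse hW).isRotated_of_isChain hW hv h1 h2)
  · have := (hu.reverse hW).isRotated_of_isChain hW (hv.reverse hW) h1 h2
    exact Or.inl (by simpa using this.reverse)

theorem EndCanonical.within (hW : WheelSet S c0) {u v : List Pt}
    (hu : EndCanonical S c0 u) (hv : EndCanonical S c0 v) : Within S 3 (c0 :: u) (c0 :: v) := by
  rcases hu.isRotated_or_reverse hW hv with h | h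
  · exact (hu.within_of_isRotated hW h).mono (by omega)
  · obtain ⟨u', h1, h2, h3⟩ := hu.exists_flip hW
    exact h2.within.trans (h1.within_of_isRotated hW (h3.trans h)) le_rfl

theorem PlaneOn.defect_le (hW : WheelSet S c0) {u : List Pt} (hP : PlaneOn S u)
    (hV : ∀ s, s ∈ u ↔ s ∈ S ∧ s ≠ c0) (hl : u.length + 1 = S.card) :
    defect S u + 4 ≤ S.card := by
  have ends : ∀ {v : List Pt}, PlaneOn S v → (∀ s, s ∈ v ↔ s ∈ S ∧ s ≠ c0) →
      ∀ x y Y, v = x :: y :: Y → HullAdj S x y := by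
    rintro v hv hV x y Y rfl
    exact hv.adj_head hW ((hV x).1 (by simp)).2 ((hV y).1 (by simp)).2
      fun s h1 h2 => (hV s).2 ⟨h1, h2⟩
  have hcard := hW.2.1
  have := defect_le_of_ends (S := S) (l := u) (by omega) (ends hP hV)
    (ends hP.reverse fun s => by rw [List.mem_reverse, hV])
  omega

theorem IsPlanePath.adj_head (hW : WheelSet S c0) {A B : List Pt} {a b : Pt}
    (hP : IsPlanePath S (A ++ a :: c0 :: b :: B)) (hab : ¬ HullAdj S a b) (x y : Pt)
    (Y : List Pt) (he : A ++ a :: c0 :: b :: B = x :: y :: Y) : HullAdj S x y := by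
  have hn := hP.1
  simp only [List.nodup_append, List.nodup_cons, List.mem_cons] at hn
  cases A with
  | nil =>
    refine absurd (hW.adj_of_same_side (hP.mem_iff.1 (by simp)) (hP.mem_iff.1 (by simp))
      (by grind) (by grind) ?_) hab
    intro p hp q hq hpc hqc hpa hpb hqa hqb
    have hp' := hP.mem_iff.2 hp
    have hq' := hP.mem_iff.2 hq
    simp only [List.nil_append, List.mem_cons, hpc, hpa, hpb, hqc, hqa, hqb, false_or] at hp' hq'
    exact hP.planeOn.sameSide_center hW p hp' q hq'
  | cons x' A =>
    have hx : x ≠ c0 := by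
      have := congrArg List.head? he
      simp at this
      grind
    have hy : y ≠ c0 := by
      have := congrArg List.tail he
      cases A <;> simp at this <;> grind
    rw [he] at hP
    exact hP.planeOn.adj_head hW hx hy fun s hs _ => hP.mem_iff.2 hs

/-- Every plane path is close to one canonical path, or almost as close to canonical paths of
both orientations. -/
theorem IsPlanePath.within_endCanonical (hW : WheelSet S c0) {P : List Pt}
    (hP : IsPlanePath S P) :
    (∃ u, EndCanonical S c0 u ∧ Within S (S.card - 4) P (c0 :: u)) ∨
      ∃ u, EndCanonical S c0 u ∧ Within S (S.card - 3) P (c0 :: u) ∧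
        Within S (S.card - 3) P (c0 :: u.reverse) := by
  have hcard := hW.2.1
  have small : defect S P + 3 ≤ S.card →
      ∃ u, EndCanonical S c0 u ∧ Within S (S.card - 4) P (c0 :: u) := by
    intro h
    obtain ⟨u, h1, h2⟩ := hP.exists_endCanonical hW
    exact ⟨u, h1, h2.mono (by omega)⟩
  have center : ∀ {u : List Pt}, IsPlanePath S (c0 :: u) → defect S (c0 :: u) + 3 ≤ S.card := by
    intro u hu
    have := hu.planeOn_tail.defect_le hW (fun _ => hu.mem_tail_iff) (by simpa using hu.length)
    rw [defect_center_cons hW (hu.tail_ne_nil hW)]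
    omega
  have hlen := hP.length
  obtain ⟨A, B, rfl⟩ := List.append_of_mem (hP.mem_iff.2 hW.2.2.1.1)
  rcases List.eq_nil_or_concat' A with rfl | ⟨A, a, rfl⟩
  · exact Or.inl (small (center hP))
  cases B with
  | nil =>
    refine Or.inl (small ?_)
    have hr := hP.reverse
    rw [← defect_reverse]
    rw [show (A ++ [a] ++ [c0]).reverse = c0 :: (A ++ [a]).reverse by simp] at hr ⊢
    exact center hr
  | cons b B =>
    rw [List.append_assoc, List.singleton_append] at hP hlen small ⊢
    by_cases hab : HullAdj S a b
    · obtain ⟨u, h1, h2, h3⟩ := hP.exists_endCanonical_both hW hab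
      obtain ⟨h4, h5⟩ := hP.planeOn_shortcut hab
      have h6 := h4.defect_le hW h5 (by simp at hlen ⊢; omega)
      have h7 : defect S (A ++ a :: c0 :: b :: B) = defect S (A ++ a :: b :: B) + 2 := by
        rw [defect_append, defect_append, if_neg (hW.not_center_adj a), defect_cons_cons,
          if_neg (hW.not_adj_center b), if_pos hab]
        ring
      exact Or.inr ⟨u, h1, h2.mono (by omega), h3.mono (by omega)⟩
    · refine Or.inl (small ?_)
      have hr : IsPlanePath S (B.reverse ++ b :: c0 :: a :: A.reverse) := by
        simpa using hP.reverse
      have := defect_le_of_ends (S := S) (by omega) (hP.adj_head hW hab)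
        (by simpa using hr.adj_head hW fun h => hab h.symm)
      omega

end CanonicalPaths

/-- For a wheel set of `n` points, the flip graph on all plane spanning paths is
connected with diameter at most `2n - 4`. -/
theorem stmt_15 (S : Finset Pt) (c0 : Pt) (hW : WheelSet S c0)
    (P Q : List Pt) (hP : IsPlanePath S P) (hQ : IsPlanePath S Q) :
    ∃ k ≤ 2 * S.card - 4, FlipSeq S (fun _ => True) k P Q := by
  have hcard := hW.2.1
  suffices h : Within S (2 * S.card - 4) P Q by
    obtain ⟨k, hk, h⟩ := h
    exact ⟨k, hk, h.flipSeq⟩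
  have both : ∀ {d e : ℕ} {P Q u v : List Pt}, EndCanonical S c0 u → EndCanonical S c0 v →
      Within S d P (c0 :: u) → Within S d P (c0 :: u.reverse) → Within S e Q (c0 :: v) →
      Within S (d + 2 + e) P Q := by
    intro d e P Q u v hu hv h1 h2 h3
    rcases hu.isRotated_or_reverse hW hv with h | h
    · exact (h1.trans (hu.within_of_isRotated hW h) le_rfl).trans h3.symm le_rfl
    · exact (h2.trans ((hu.reverse hW).within_of_isRotated hW h) le_rfl).trans h3.symm le_rfl
  rcases hP.within_endCanonical hW with ⟨u, hu, h1⟩ | ⟨u, hu, h1, h2⟩ <;>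
    rcases hQ.within_endCanonical hW with ⟨v, hv, h3⟩ | ⟨v, hv, h3, h4⟩
  · exact (h1.trans (hu.within hW hv) le_rfl).trans h3.symm (by omega)
  · exact (both hv hu h3 h4 h1).symm.mono (by omega)
  · exact (both hu hv h1 h2 h3).mono (by omega)
  · exact (both hu hv h1 h2 h3).mono (by omega)
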